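/- arXiv:1612.00736 — 2 statements merged into one kernel-verified Lean document; each statement's English description precedes it below -/
import Mathlib

section
/- Let (W,S) be a Coxeter system of finite rank. Every parabolic double coset C of W has a unique lex-minimal presentation: there exist unique I, J ⊆ S and w ∈ W with C = W_I w W_J such that w is the minimal-length element of C and, among all presentations C = W_{I'} w W_{J'}, the pair (|I|, |J|) is lexicographically minimal. -/
open CoxeterSystem

variable {B : Type*} {W : Type*} [Group W]

/-- The standard parabolic subgroup `W_I` of a Coxeter system, generated by the
simple reflections indexed by `I`. -/
def CoxeterSystem.parabolic {M : CoxeterMatrix B} (cs : CoxeterSystem M W) (I : Set B) :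
    Subgroup W :=
  Subgroup.closure (cs.simple '' I)

/-- The parabolic double coset `W_I w W_J`. -/
def CoxeterSystem.doubleCoset {M : CoxeterMatrix B} (cs : CoxeterSystem M W) (I : Set B)
    (w : W) (J : Set B) : Set W :=
  {x | ∃ u ∈ cs.parabolic I, ∃ v ∈ cs.parabolic J, x = u * w * v}

/-- `(I, w, J)` is a lex-minimal presentation of the parabolic double coset `W_I w W_J`
if `w` is the unique minimal-length element of the coset and, among all presentations
of the coset with the same `w`, the pair `(|I|, |J|)` is lexicographically minimal. -/
def CoxeterSystem.IsLexMinimalPresentation {M : CoxeterMatrix B} (cs : CoxeterSystem M W)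
    (I : Set B) (w : W) (J : Set B) : Prop :=
  (∀ x ∈ cs.doubleCoset I w J, x ≠ w → cs.length w < cs.length x) ∧
  (∀ I' J' : Set B, cs.doubleCoset I' w J' = cs.doubleCoset I w J →
    I.ncard < I'.ncard ∨ (I.ncard = I'.ncard ∧ J.ncard ≤ J'.ncard))

namespace CoxeterSystem

/-! ### The simple reflections are pairwise distinct -/

section GeometricRepresentation

/-- The functional `x ↦ 2 B(eᵢ, x)`, where `B` is the Tits form of the Coxeter matrix. -/
noncomputable def titsCoroot (M : CoxeterMatrix B) (i : B) : Module.Dual ℝ (B →₀ ℝ) :=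
  Finsupp.linearCombination ℝ fun j => -2 * Real.cos (Real.pi / M i j)

theorem titsCoroot_single (M : CoxeterMatrix B) (i j : B) :
    titsCoroot M i (Finsupp.single j 1) = -2 * Real.cos (Real.pi / M i j) := by
  simp [titsCoroot]

theorem titsCoroot_single_self (M : CoxeterMatrix B) (i : B) :
    titsCoroot M i (Finsupp.single i 1) = 2 := by
  simp [titsCoroot_single]

/-- The action of a simple reflection in the geometric representation. -/
noncomputable def titsReflection (M : CoxeterMatrix B) (i : B) :
    (B →₀ ℝ) ≃ₗ[ℝ] (B →₀ ℝ) :=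
  Module.reflection (titsCoroot_single_self M i)

open Polynomial in
theorem eval_chebyshev_S_two_mul_cos_eq_zero {k : ℤ} {θ : ℝ} (hθ : Real.sin θ ≠ 0)
    (hk : Real.sin ((k + 1) * θ) = 0) : (Chebyshev.S ℝ k).eval (2 * Real.cos θ) = 0 := by
  have h := Chebyshev.S_two_mul_real_cos θ k
  rw [hk] at h
  exact (mul_eq_zero.mp h).resolve_right hθ

open Polynomial in
theorem eval_chebyshev_S_add_eq_zero {k : ℤ} {θ : ℝ} (hθ : Real.sin θ ≠ 0)
    (hk : (2 * k + 1) * θ = 2 * Real.pi) :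
    (Chebyshev.S ℝ k).eval (2 * Real.cos θ) +
      (Chebyshev.S ℝ (k - 1)).eval (2 * Real.cos θ) = 0 := by
  have h₁ := Chebyshev.S_two_mul_real_cos θ k
  have h₂ := Chebyshev.S_two_mul_real_cos θ (k - 1)
  have h₃ : Real.sin ((k + 1) * θ) = -Real.sin (k * θ) := by
    rw [← Real.sin_two_pi_sub, ← hk]
    ring_nf
  refine (mul_eq_zero.mp (?_ : _ * Real.sin θ = 0)).resolve_right hθ
  push_cast at h₂
  rw [add_mul, h₁, h₂, h₃]
  ring_nf

theorem isLiftable_titsReflection (M : CoxeterMatrix B) : M.IsLiftable (titsReflection M) := by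
  intro i j
  rcases eq_or_ne i j with rfl | hij
  · rw [M.diagonal, pow_one]
    ext1 z
    exact Module.involutive_reflection (titsCoroot_single_self M i) z
  have key : ∀ m : ℕ, M i j = m → (titsReflection M i * titsReflection M j) ^ m = 1 := by
    intro m hm
    have hg : titsCoroot M j (Finsupp.single i 1) = -2 * Real.cos (Real.pi / m) := by
      rw [titsCoroot_single, M.symmetric, hm]
    have hf : titsCoroot M i (Finsupp.single j 1) = -2 * Real.cos (Real.pi / m) := by
      rw [titsCoroot_single, hm]
    have ht : 2 * Real.cos (2 * Real.pi / m) = titsCoroot M i (Finsupp.single j 1) *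
        titsCoroot M j (Finsupp.single i 1) - 2 := by
      rw [hf, hg, mul_div_assoc, Real.cos_two_mul]
      ring
    ext1 z
    rw [titsReflection, titsReflection, Module.reflection_mul_reflection_pow_apply _ _ m z _ ht]
    rcases lt_or_ge m 3 with h3 | h3
    · interval_cases m
      · simp
      · exact absurd hm (M.off_diagonal i j hij)
      · simp only [hf, hg]
        simp [Real.cos_pi_div_two]
        module
    · have hm0 : (m : ℝ) ≠ 0 := by positivity
      have hθ : Real.sin (2 * Real.pi / m) ≠ 0 := by
        refine (Real.sin_pos_of_pos_of_lt_pi (by positivity) ?_).ne'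
        rw [div_lt_iff₀ (by positivity)]
        have : (3 : ℝ) ≤ m := by exact_mod_cast h3
        nlinarith [Real.pi_pos]
      rcases Nat.even_or_odd' m with ⟨k, rfl | rfl⟩
      · have h0 := eval_chebyshev_S_two_mul_cos_eq_zero (k := k - 1) hθ (by
          rw [Real.sin_eq_zero_iff]
          have hk : (k : ℝ) ≠ 0 := by
            rintro h
            simp [h] at hm0
          refine ⟨1, ?_⟩
          push_cast
          field_simp
          ring)
        have e₁ : (((2 * k : ℕ) : ℤ) - 2) / 2 = k - 1 := by omega
        have e₂ : (((2 * k : ℕ) : ℤ) - 1) / 2 = k - 1 := by omega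
        rw [e₁, e₂, h0]
        simp
      · have h0 := eval_chebyshev_S_add_eq_zero (k := k) hθ (by
          push_cast at hm0 ⊢
          field_simp)
        have e₁ : (((2 * k + 1 : ℕ) : ℤ) - 2) / 2 = k - 1 := by omega
        have e₂ : (((2 * k + 1 : ℕ) : ℤ) - 1) / 2 = k := by omega
        have e₃ : (((2 * k + 1 : ℕ) : ℤ) - 3) / 2 = k - 1 := by omega
        have e₄ : ((2 * k + 1 : ℕ) : ℤ) / 2 = k := by omega
        rw [e₁, e₂, e₃, e₄, h0]
        simp
  exact key _ rfl

theorem simple_injective {M : CoxeterMatrix B} (cs : CoxeterSystem M W) :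
    Function.Injective cs.simple := by
  intro i j hij
  by_contra hne
  have h : titsReflection M i = titsReflection M j := by
    rw [← cs.lift_apply_simple (isLiftable_titsReflection M) i, hij, cs.lift_apply_simple]
  have h' := DFunLike.congr_fun (DFunLike.congr_fun h (Finsupp.single i 1)) i
  rw [titsReflection, titsReflection, Module.reflection_apply, Module.reflection_apply,
    titsCoroot_single_self] at h'
  simp [Ne.symm hne] at h'

end GeometricRepresentation

variable {M : CoxeterMatrix B} (cs : CoxeterSystem M W)

/-! ### The exchange property -/

section Exchange

open scoped Classical in
/-- The action of a simple reflection on signed group elements: conjugation, changing the sign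
of the simple reflection itself. -/
noncomputable def signedConj (i : B) : Equiv.Perm (W × ZMod 2) :=
  Function.Involutive.toPerm
    (fun p => (cs.simple i * p.1 * cs.simple i, p.2 + if p.1 = cs.simple i then 1 else 0)) <| by
    rintro ⟨t, ε⟩
    have h : cs.simple i * t * cs.simple i = cs.simple i ↔ t = cs.simple i := by
      constructor
      · intro h
        have h' := congrArg (fun x => cs.simple i * x * cs.simple i) h
        simpa [mul_assoc] using h'
      · rintro rfl
        simp
    ext
    · simp [mul_assoc]
    · simp only [h]
      split_ifs
      · rw [add_assoc, CharTwo.add_self_eq_zero, add_zero]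
      · simp

open scoped Classical in
theorem prod_map_signedConj_apply (ω : List B) (t : W) (ε : ZMod 2) :
    (ω.map cs.signedConj).prod (t, ε) =
      (cs.wordProd ω * t * (cs.wordProd ω)⁻¹, ε + (cs.rightInvSeq ω).count t) := by
  induction ω with
  | nil => simp
  | cons i ω ih =>
    rw [List.map_cons, List.prod_cons, Equiv.Perm.mul_apply, ih]
    have h : cs.wordProd ω * t * (cs.wordProd ω)⁻¹ = cs.simple i ↔
        (cs.wordProd ω)⁻¹ * cs.simple i * cs.wordProd ω = t := by
      constructor
      · intro h
        rw [← h]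
        group
      · rintro rfl
        group
    change (_, _ + if cs.wordProd ω * t * (cs.wordProd ω)⁻¹ = cs.simple i then 1 else 0) = _
    simp only [rightInvSeq, wordProd_cons, List.count_cons, beq_iff_eq, h]
    ext
    · simp [mul_assoc]
    · simp [add_assoc]

open scoped Classical in
theorem even_count_leftInvSeq_alternatingWord (i j : B) (t : W) :
    Even ((cs.leftInvSeq (alternatingWord i j (2 * M i j))).count t) := by
  set m := M i j
  have hl : cs.leftInvSeq (alternatingWord i j (2 * m)) =
      (List.range (m + m)).map fun k => cs.simple i * (cs.simple j * cs.simple i) ^ k := by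
    refine List.ext_getElem (by simp [two_mul]) fun k hk hk' => ?_
    rw [cs.getElem_leftInvSeq_alternatingWord i j m k (by simpa using hk),
      prod_alternatingWord_eq_mul_pow]
    have h₂ : (2 * k + 1) / 2 = k := by omega
    simp [h₂]
  have hp : (cs.simple j * cs.simple i) ^ m = 1 := cs.simple_mul_simple_pow' i j
  rw [hl, List.range_add, List.map_append, List.map_map, List.count_append]
  refine ⟨_, congrArg₂ _ rfl ?_⟩
  congr 2
  funext k
  simp [pow_add, hp]

theorem prod_map_alternatingWord {G : Type*} [Monoid G] (f : B → G) (i j : B) (m : ℕ) :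
    ((alternatingWord i j (2 * m)).map f).prod = (f i * f j) ^ m := by
  induction m with
  | zero => simp [alternatingWord]
  | succ m ih =>
    rw [mul_add, mul_one, alternatingWord_succ', alternatingWord_succ', List.map_cons,
      List.map_cons, List.prod_cons, List.prod_cons, ih, pow_succ', ← mul_assoc]
    simp

theorem reverse_alternatingWord (i j : B) (m : ℕ) :
    (alternatingWord i j (2 * m)).reverse = alternatingWord j i (2 * m) := by
  refine List.ext_getElem (by simp) fun k hk hk' => ?_
  simp only [length_alternatingWord] at hk'
  rw [List.getElem_reverse, getElem_alternatingWord _ _ _ _ (by simp; omega),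
    getElem_alternatingWord _ _ _ _ hk']
  simp only [length_alternatingWord]
  have h : Even (2 * m + (2 * m - 1 - k)) ↔ ¬ Even (2 * m + k) := by
    simp only [Nat.even_iff]
    omega
  simp only [h]
  split_ifs <;> rfl

theorem isLiftable_signedConj : M.IsLiftable cs.signedConj := by
  classical
  intro i j
  rw [← prod_map_alternatingWord]
  ext1 ⟨t, ε⟩
  have h₁ : cs.wordProd (alternatingWord i j (2 * M i j)) = 1 := by
    rw [wordProd, prod_map_alternatingWord, simple_mul_simple_pow]
  have h₂ : cs.rightInvSeq (alternatingWord i j (2 * M i j)) =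
      (cs.leftInvSeq (alternatingWord j i (2 * M j i))).reverse := by
    rw [M.symmetric j i, ← reverse_alternatingWord i j, leftInvSeq_reverse, List.reverse_reverse]
  have h₃ : (((cs.rightInvSeq (alternatingWord i j (2 * M i j))).count t : ℕ) : ZMod 2) = 0 := by
    rw [h₂, List.count_reverse, ZMod.natCast_eq_zero_iff_even]
    exact cs.even_count_leftInvSeq_alternatingWord j i t
  rw [prod_map_signedConj_apply, h₁, h₃]
  simp

open scoped Classical in
theorem count_rightInvSeq_congr {ω ω' : List B} (h : cs.wordProd ω = cs.wordProd ω') (t : W) :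
    ((cs.rightInvSeq ω).count t : ZMod 2) = (cs.rightInvSeq ω').count t := by
  have hlift : ∀ ω : List B, (ω.map cs.signedConj).prod =
      cs.lift ⟨cs.signedConj, cs.isLiftable_signedConj⟩ (cs.wordProd ω) := by
    intro ω
    rw [wordProd, map_list_prod, List.map_map]
    congr 2
    funext i
    simp [lift_apply_simple]
  have h₁ := cs.prod_map_signedConj_apply ω t 0
  rw [hlift, h, ← hlift, prod_map_signedConj_apply] at h₁
  simpa using (congrArg Prod.snd h₁).symm

theorem simple_mem_rightInvSeq {ω : List B} {i : B} (h : cs.IsRightDescent (cs.wordProd ω) i) :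
    cs.simple i ∈ cs.rightInvSeq ω := by
  classical
  obtain ⟨α, hα, hαω⟩ := cs.exists_isReduced (cs.wordProd ω * cs.simple i)
  have hprod : cs.wordProd ω = cs.wordProd (α.concat i) := by
    rw [wordProd_concat, ← hαω, simple_mul_simple_cancel_right]
  have hred : cs.IsReduced (α.concat i) := by
    have h₁ := cs.isRightDescent_iff.mp h
    rw [hαω, hα.eq, hprod] at h₁
    rw [IsReduced, ← h₁]
    simp
  have hmem : cs.simple i ∈ cs.rightInvSeq (α.concat i) := by
    rw [rightInvSeq_concat]
    simp
  have hcount := cs.count_rightInvSeq_congr hprod (cs.simple i)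
  rw [List.count_eq_one_of_mem hred.nodup_rightInvSeq hmem] at hcount
  by_contra hnot
  rw [List.count_eq_zero_of_not_mem hnot] at hcount
  simp at hcount

/-- The exchange property for words. -/
theorem exists_simple_mul_wordProd_eq_eraseIdx {ω : List B} {i : B}
    (h : cs.IsLeftDescent (cs.wordProd ω) i) :
    ∃ k < ω.length, cs.simple i * cs.wordProd ω = cs.wordProd (ω.eraseIdx k) := by
  have hmem : cs.simple i ∈ cs.leftInvSeq ω := by
    have h' : cs.IsRightDescent (cs.wordProd ω.reverse) i := by
      rwa [wordProd_reverse, isRightDescent_inv_iff]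
    simpa [rightInvSeq_reverse] using cs.simple_mem_rightInvSeq h'
  obtain ⟨k, hk, hki⟩ := List.mem_iff_getElem.mp hmem
  refine ⟨k, by simpa using hk, ?_⟩
  rw [← getD_leftInvSeq_mul_wordProd, List.getD_eq_getElem _ _ hk, hki]

end Exchange

/-! ### Parabolic subgroups -/

theorem simple_mem_parabolic {I : Set B} {i : B} (hi : i ∈ I) : cs.simple i ∈ cs.parabolic I :=
  Subgroup.subset_closure ⟨i, hi, rfl⟩

theorem parabolic_mono {I J : Set B} (h : I ⊆ J) : cs.parabolic I ≤ cs.parabolic J :=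
  Subgroup.closure_mono (Set.image_mono h)

theorem mem_parabolic_univ (w : W) : w ∈ cs.parabolic Set.univ := by
  rw [parabolic, Set.image_univ, subgroup_closure_range_simple]
  trivial

theorem wordProd_mem_parabolic {I : Set B} {ω : List B} (h : ∀ i ∈ ω, i ∈ I) :
    cs.wordProd ω ∈ cs.parabolic I := by
  refine Subgroup.list_prod_mem _ fun x hx => ?_
  obtain ⟨i, hi, rfl⟩ := List.mem_map.mp hx
  exact cs.simple_mem_parabolic (h i hi)

theorem exists_isReduced_of_mem_parabolic {I : Set B} {u : W} (hu : u ∈ cs.parabolic I) :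
    ∃ ω : List B, cs.IsReduced ω ∧ (∀ i ∈ ω, i ∈ I) ∧ u = cs.wordProd ω := by
  have step : ∀ i ∈ I, ∀ y : W,
      (∃ ω : List B, cs.IsReduced ω ∧ (∀ i ∈ ω, i ∈ I) ∧ y = cs.wordProd ω) →
      ∃ ω : List B, cs.IsReduced ω ∧ (∀ i ∈ ω, i ∈ I) ∧ cs.simple i * y = cs.wordProd ω := by
    rintro i hi _ ⟨ω, hω, hωI, rfl⟩
    by_cases hd : cs.IsLeftDescent (cs.wordProd ω) i
    · obtain ⟨k, hk, hkω⟩ := cs.exists_simple_mul_wordProd_eq_eraseIdx hd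
      refine ⟨ω.eraseIdx k, ?_, fun j hj => hωI j (List.mem_of_mem_eraseIdx hj), hkω⟩
      have h₁ := cs.isLeftDescent_iff.mp hd
      rw [hkω, hω.eq] at h₁
      rw [IsReduced, List.length_eraseIdx_of_lt hk]
      omega
    · refine ⟨i :: ω, ?_, by simpa using ⟨hi, hωI⟩, (cs.wordProd_cons i ω).symm⟩
      have h₁ := cs.not_isLeftDescent_iff.mp hd
      rw [IsReduced, wordProd_cons, h₁, hω.eq, List.length_cons]
  refine Subgroup.closure_induction_left (p := fun u _ => ∃ ω : List B, cs.IsReduced ω ∧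
    (∀ i ∈ ω, i ∈ I) ∧ u = cs.wordProd ω) ⟨[], by simp [IsReduced], by simp, by simp⟩ ?_ ?_ hu
  · rintro _ ⟨i, hi, rfl⟩ y _ hy
    exact step i hi y hy
  · rintro _ ⟨i, hi, rfl⟩ y _ hy
    rw [inv_simple]
    exact step i hi y hy

/-- The exchange property for a product of two elements of parabolic subgroups. -/
theorem exchange_mul {I J : Set B} {a b : W} (ha : a ∈ cs.parabolic I) (hb : b ∈ cs.parabolic J)
    {i : B} (h : cs.IsLeftDescent (a * b) i) :
    (cs.simple i * a ∈ cs.parabolic I ∧ cs.length (cs.simple i * a) < cs.length a) ∨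
      ∃ b' ∈ cs.parabolic J, cs.length b' < cs.length b ∧ cs.simple i * (a * b) = a * b' := by
  obtain ⟨α, hα, hαI, rfl⟩ := cs.exists_isReduced_of_mem_parabolic ha
  obtain ⟨β, hβ, hβJ, rfl⟩ := cs.exists_isReduced_of_mem_parabolic hb
  rw [← wordProd_append] at h
  obtain ⟨k, hk, hkω⟩ := cs.exists_simple_mul_wordProd_eq_eraseIdx h
  rw [List.length_append] at hk
  rcases lt_or_ge k α.length with hkα | hkα
  · left
    rw [List.eraseIdx_append_of_lt_length hkα, wordProd_append, wordProd_append, ← mul_assoc,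
      mul_left_inj] at hkω
    rw [hkω]
    refine ⟨cs.wordProd_mem_parabolic fun j hj => hαI j (List.mem_of_mem_eraseIdx hj), ?_⟩
    refine (cs.length_wordProd_le _).trans_lt ?_
    rw [hα.eq, List.length_eraseIdx_of_lt hkα]
    omega
  · right
    rw [List.eraseIdx_append_of_length_le hkα, wordProd_append, wordProd_append] at hkω
    refine ⟨_, cs.wordProd_mem_parabolic fun j hj => hβJ j (List.mem_of_mem_eraseIdx hj), ?_, hkω⟩
    refine (cs.length_wordProd_le _).trans_lt ?_
    rw [hβ.eq, List.length_eraseIdx_of_lt (by omega)]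
    omega

theorem mem_of_isLeftDescent_of_mem_parabolic {I : Set B} {u : W} (hu : u ∈ cs.parabolic I)
    {i : B} (h : cs.IsLeftDescent u i) : i ∈ I := by
  have hi : cs.simple i ∈ cs.parabolic I := by
    rw [← mul_one u] at h
    rcases cs.exchange_mul hu (cs.parabolic I).one_mem h with ⟨h₁, -⟩ | ⟨b', -, hb', -⟩
    · simpa using (cs.parabolic I).mul_mem h₁ ((cs.parabolic I).inv_mem hu)
    · simp at hb'
  obtain ⟨ω, hω, hωI, hiω⟩ := cs.exists_isReduced_of_mem_parabolic hi
  have hlen : ω.length = 1 := by rw [← hω.eq, ← hiω, length_simple]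
  obtain ⟨j, rfl⟩ := List.length_eq_one_iff.mp hlen
  rw [wordProd_singleton] at hiω
  rw [cs.simple_injective hiω]
  exact hωI j (by simp)

theorem mem_parabolic_inter {I J : Set B} {u : W} (hI : u ∈ cs.parabolic I)
    (hJ : u ∈ cs.parabolic J) : u ∈ cs.parabolic (I ∩ J) := by
  induction hn : cs.length u using Nat.strong_induction_on generalizing u with
  | _ n ih =>
    by_cases hu : u = 1
    · rw [hu]
      exact Subgroup.one_mem _
    · obtain ⟨i, hi⟩ := cs.exists_leftDescent_of_ne_one hu
      have hiI := cs.mem_of_isLeftDescent_of_mem_parabolic hI hi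
      have hiJ := cs.mem_of_isLeftDescent_of_mem_parabolic hJ hi
      have h := ih _ (hn ▸ hi) ((cs.parabolic I).mul_mem (cs.simple_mem_parabolic hiI) hI)
        ((cs.parabolic J).mul_mem (cs.simple_mem_parabolic hiJ) hJ) rfl
      simpa using (cs.parabolic (I ∩ J)).mul_mem (cs.simple_mem_parabolic ⟨hiI, hiJ⟩) h

/-! ### Minimal coset representatives -/

theorem eq_of_forall_not_isLeftDescent_of_forall_length_le {I : Set B} {h x : W}
    (hh : h ∈ cs.parabolic I) (hx : ∀ g ∈ cs.parabolic I, cs.length x ≤ cs.length (g * x))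
    (hy : ∀ i ∈ I, ¬ cs.IsLeftDescent (h * x) i) : h * x = x := by
  by_contra hne
  have hh1 : h ≠ 1 := by
    rintro rfl
    simp at hne
  obtain ⟨i, hi⟩ := cs.exists_leftDescent_of_ne_one hh1
  have hiI := cs.mem_of_isLeftDescent_of_mem_parabolic hh hi
  have hh' := (cs.parabolic I).mul_mem (cs.simple_mem_parabolic hiI) hh
  have hd : cs.IsLeftDescent (cs.simple i * h * x) i := by
    rw [isLeftDescent_iff_not_isLeftDescent_mul, mul_assoc, simple_mul_simple_cancel_left]
    exact hy i hiI
  rcases cs.exchange_mul hh' (cs.mem_parabolic_univ x) hd with ⟨-, h₁⟩ | ⟨b, -, hb, hbx⟩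
  · rw [simple_mul_simple_cancel_left] at h₁
    exact lt_asymm h₁ hi
  · rw [mul_assoc, simple_mul_simple_cancel_left] at hbx
    have hb' : ((cs.simple i * h)⁻¹ * h) * x = b := by
      rw [mul_assoc, hbx]
      group
    have := hx _ ((cs.parabolic I).mul_mem ((cs.parabolic I).inv_mem hh') hh)
    rw [hb'] at this
    omega

theorem exists_forall_length_le {C : Set W} (hC : C.Nonempty) :
    ∃ w ∈ C, ∀ x ∈ C, cs.length w ≤ cs.length x := by
  obtain ⟨w, hw, hmin⟩ := (InvImage.wf cs.length wellFounded_lt).has_min C hC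
  exact ⟨w, hw, fun x hx => not_lt.mp (hmin x hx)⟩

theorem eq_of_forall_not_isLeftDescent {I : Set B} {h x : W} (hh : h ∈ cs.parabolic I)
    (hx : ∀ i ∈ I, ¬ cs.IsLeftDescent x i) (hy : ∀ i ∈ I, ¬ cs.IsLeftDescent (h * x) i) :
    h * x = x := by
  obtain ⟨_, ⟨g, hg, rfl⟩, hmin⟩ := cs.exists_forall_length_le
    (C := {y | ∃ g ∈ cs.parabolic I, y = g * x}) ⟨x, 1, Subgroup.one_mem _, by simp⟩
  have hmin' : ∀ k ∈ cs.parabolic I, cs.length (g * x) ≤ cs.length (k * (g * x)) :=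
    fun k hk => hmin _ ⟨k * g, mul_mem hk hg, (mul_assoc _ _ _).symm⟩
  have h₁ := cs.eq_of_forall_not_isLeftDescent_of_forall_length_le (inv_mem hg) hmin'
    (by simpa using hx)
  have h₂ := cs.eq_of_forall_not_isLeftDescent_of_forall_length_le (mul_mem hh (inv_mem hg)) hmin'
    (by simpa [mul_assoc] using hy)
  simp only [inv_mul_cancel_left, mul_assoc] at h₁ h₂
  rw [h₂, ← h₁]

/-! ### Double cosets -/

theorem mul_mul_mem_doubleCoset {I J : Set B} {w x u v : W} (hx : x ∈ cs.doubleCoset I w J)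
    (hu : u ∈ cs.parabolic I) (hv : v ∈ cs.parabolic J) : u * x * v ∈ cs.doubleCoset I w J := by
  obtain ⟨a, ha, b, hb, rfl⟩ := hx
  exact ⟨u * a, mul_mem hu ha, b * v, mul_mem hb hv, by simp only [mul_assoc]⟩

theorem self_mem_doubleCoset (I J : Set B) (w : W) : w ∈ cs.doubleCoset I w J :=
  ⟨1, Subgroup.one_mem _, 1, Subgroup.one_mem _, by simp⟩

theorem doubleCoset_eq_of_mem {I J : Set B} {w x : W} (hx : x ∈ cs.doubleCoset I w J) :
    cs.doubleCoset I x J = cs.doubleCoset I w J := by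
  apply Set.Subset.antisymm
  · rintro _ ⟨u, hu, v, hv, rfl⟩
    exact cs.mul_mul_mem_doubleCoset hx hu hv
  · obtain ⟨a, ha, b, hb, rfl⟩ := hx
    rintro _ ⟨u, hu, v, hv, rfl⟩
    exact ⟨u * a⁻¹, mul_mem hu (inv_mem ha), b⁻¹ * v, mul_mem (inv_mem hb) hv, by group⟩

theorem doubleCoset_mono {I I' J J' : Set B} (hI : I ⊆ I') (hJ : J ⊆ J') (w : W) :
    cs.doubleCoset I w J ⊆ cs.doubleCoset I' w J' := by
  rintro _ ⟨u, hu, v, hv, rfl⟩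
  exact ⟨u, cs.parabolic_mono hI hu, v, cs.parabolic_mono hJ hv, rfl⟩

theorem inv_mem_doubleCoset_iff {I J : Set B} {w x : W} :
    x⁻¹ ∈ cs.doubleCoset I w⁻¹ J ↔ x ∈ cs.doubleCoset J w I := by
  constructor
  · rintro ⟨u, hu, v, hv, h⟩
    refine ⟨v⁻¹, inv_mem hv, u⁻¹, inv_mem hu, ?_⟩
    rw [← inv_inv x, h]
    group
  · rintro ⟨u, hu, v, hv, rfl⟩
    exact ⟨v⁻¹, inv_mem hv, u⁻¹, inv_mem hu, by group⟩

theorem doubleCoset_inv_eq_iff {I I' J J' : Set B} {w : W} :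
    cs.doubleCoset I w⁻¹ J = cs.doubleCoset I' w⁻¹ J' ↔
      cs.doubleCoset J w I = cs.doubleCoset J' w I' := by
  simp only [Set.ext_iff]
  rw [(Equiv.inv W).forall_congr_left]
  simp [inv_mem_doubleCoset_iff]

theorem not_isLeftDescent_of_forall_length_le {I J : Set B} {w : W}
    (hw : ∀ x ∈ cs.doubleCoset I w J, cs.length w ≤ cs.length x) {i : B} (hi : i ∈ I) :
    ¬ cs.IsLeftDescent w i := by
  intro h
  refine (hw _ ⟨_, cs.simple_mem_parabolic hi, 1, Subgroup.one_mem _, rfl⟩).not_gt ?_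
  rwa [mul_one]

/-- Every element of `W_I w W_J` is `W_I`-equivalent to some `w v`, with `v ∈ W_J`, that has no
left descent in `I`, provided `w` has none. -/
theorem exists_eq_mul_of_mem_doubleCoset {I J : Set B} {w x : W}
    (hw : ∀ i ∈ I, ¬ cs.IsLeftDescent w i) (hx : x ∈ cs.doubleCoset I w J) :
    ∃ h ∈ cs.parabolic I, ∃ v ∈ cs.parabolic J, x = h * (w * v) ∧
      ∀ i ∈ I, ¬ cs.IsLeftDescent (w * v) i := by
  obtain ⟨v, ⟨hv, h, hh, hxv⟩, hmin⟩ := cs.exists_forall_length_le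
    (C := {v | v ∈ cs.parabolic J ∧ ∃ h ∈ cs.parabolic I, x = h * (w * v)}) <| by
      obtain ⟨h, hh, v, hv, rfl⟩ := hx
      exact ⟨v, hv, h, hh, mul_assoc _ _ _⟩
  refine ⟨h, hh, v, hv, hxv, fun i hi hd => ?_⟩
  rcases cs.exchange_mul (cs.mem_parabolic_univ w) hv hd with ⟨-, h₁⟩ | ⟨v', hv', hlt, h₁⟩
  · exact hw i hi h₁
  · refine (hmin v' ⟨hv', h * cs.simple i, mul_mem hh (cs.simple_mem_parabolic hi), ?_⟩).not_gt hlt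
    rw [hxv, ← h₁]
    simp [mul_assoc]

/-- An element of minimal length of a parabolic double coset is unique. -/
theorem length_lt_of_mem_doubleCoset {I J : Set B} {w x : W}
    (hw : ∀ y ∈ cs.doubleCoset I w J, cs.length w ≤ cs.length y)
    (hx : x ∈ cs.doubleCoset I w J) (hxw : x ≠ w) : cs.length w < cs.length x := by
  by_contra! hle
  apply hxw
  have hxmin : ∀ y ∈ cs.doubleCoset I x J, cs.length x ≤ cs.length y := by
    rw [cs.doubleCoset_eq_of_mem hx]
    exact fun y hy => hle.trans (hw y hy)
  obtain ⟨h, hh, v, hv, rfl, hd⟩ := cs.exists_eq_mul_of_mem_doubleCoset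
    (fun i hi => cs.not_isLeftDescent_of_forall_length_le hw hi) hx
  have hxv := cs.eq_of_forall_not_isLeftDescent hh hd
    fun i hi => cs.not_isLeftDescent_of_forall_length_le hxmin hi
  rw [hxv] at hxmin ⊢
  have hinv : ∀ z : W, (∀ y ∈ cs.doubleCoset I z J, cs.length z ≤ cs.length y) →
      ∀ j ∈ J, ¬ cs.IsLeftDescent z⁻¹ j := by
    intro z hz j hj
    refine cs.not_isLeftDescent_of_forall_length_le (I := J) (J := I) (fun y hy => ?_) hj
    rw [← inv_inv y, inv_mem_doubleCoset_iff] at hy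
    simpa using hz _ hy
  have h₁ := cs.eq_of_forall_not_isLeftDescent (inv_mem hv) (hinv w hw)
    (by simpa using hinv _ hxmin)
  rw [← inv_inj, mul_inv_rev, h₁]

theorem doubleCoset_inter_right {I J J' : Set B} {w : W}
    (hw : ∀ x ∈ cs.doubleCoset I w J, cs.length w ≤ cs.length x)
    (h : cs.doubleCoset I w J = cs.doubleCoset I w J') :
    cs.doubleCoset I w (J ∩ J') = cs.doubleCoset I w J := by
  refine (cs.doubleCoset_mono subset_rfl Set.inter_subset_left w).antisymm fun x hx => ?_
  have hw' : ∀ i ∈ I, ¬ cs.IsLeftDescent w i :=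
    fun i hi => cs.not_isLeftDescent_of_forall_length_le hw hi
  obtain ⟨a, ha, v, hv, hxv, hd⟩ := cs.exists_eq_mul_of_mem_doubleCoset hw' hx
  obtain ⟨a', ha', v', hv', hxv', hd'⟩ := cs.exists_eq_mul_of_mem_doubleCoset hw' (h ▸ hx)
  have he : (a'⁻¹ * a) * (w * v) = w * v' := by
    rw [mul_assoc, ← hxv, hxv']
    group
  have he' := cs.eq_of_forall_not_isLeftDescent (mul_mem (inv_mem ha') ha) hd (he ▸ hd')
  rw [he, mul_right_inj] at he'
  subst he'
  exact ⟨a, ha, v', cs.mem_parabolic_inter hv hv', by rw [hxv, mul_assoc]⟩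

theorem doubleCoset_inter_left {I I' J : Set B} {w : W}
    (hw : ∀ x ∈ cs.doubleCoset I w J, cs.length w ≤ cs.length x)
    (h : cs.doubleCoset I w J = cs.doubleCoset I' w J) :
    cs.doubleCoset (I ∩ I') w J = cs.doubleCoset I w J := by
  rw [← doubleCoset_inv_eq_iff] at h ⊢
  refine cs.doubleCoset_inter_right (fun x hx => ?_) h
  rw [← inv_inv x, inv_mem_doubleCoset_iff] at hx
  simpa using hw _ hx

theorem doubleCoset_union_right {I I' J J' : Set B} {w : W}
    (h : cs.doubleCoset I w J = cs.doubleCoset I' w J') :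
    cs.doubleCoset I w (J ∪ J') = cs.doubleCoset I w J := by
  refine Set.Subset.antisymm ?_ (cs.doubleCoset_mono subset_rfl Set.subset_union_left w)
  rintro _ ⟨u, hu, v, hv, rfl⟩
  have key : ∀ x ∈ cs.doubleCoset I w J, ∀ i ∈ J ∪ J', x * cs.simple i ∈ cs.doubleCoset I w J := by
    rintro x hx i (hi | hi)
    · simpa using cs.mul_mul_mem_doubleCoset hx (Subgroup.one_mem _) (cs.simple_mem_parabolic hi)
    · rw [h] at hx ⊢
      simpa using cs.mul_mul_mem_doubleCoset hx (Subgroup.one_mem _) (cs.simple_mem_parabolic hi)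
  refine Subgroup.closure_induction_right
    (p := fun v _ => u * w * v ∈ cs.doubleCoset I w J) ?_ ?_ ?_ hv
  · exact ⟨u, hu, 1, Subgroup.one_mem _, rfl⟩
  · rintro y _ _ ⟨i, hi, rfl⟩ hy
    rw [← mul_assoc]
    exact key _ hy i hi
  · rintro y _ _ ⟨i, hi, rfl⟩ hy
    rw [← mul_assoc, inv_simple]
    exact key _ hy i hi

namespace IsLexMinimalPresentation

variable {cs} {I I' J J' : Set B} {w w' : W}

theorem length_le (h : cs.IsLexMinimalPresentation I w J) :
    ∀ x ∈ cs.doubleCoset I w J, cs.length w ≤ cs.length x := by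
  intro x hx
  rcases eq_or_ne x w with rfl | hne
  · rfl
  · exact (h.1 x hx hne).le

theorem element_eq (h : cs.IsLexMinimalPresentation I w J)
    (h' : cs.IsLexMinimalPresentation I' w' J')
    (hC : cs.doubleCoset I w J = cs.doubleCoset I' w' J') : w = w' := by
  by_contra hne
  have h₁ := h.1 w' (hC ▸ cs.self_mem_doubleCoset I' J' w') (Ne.symm hne)
  have h₂ := h'.1 w (hC ▸ cs.self_mem_doubleCoset I J w) hne
  exact lt_asymm h₁ h₂

theorem left_subset [Finite B] (h : cs.IsLexMinimalPresentation I w J)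
    (hC : cs.doubleCoset I w J = cs.doubleCoset I' w J') : I ⊆ I' := by
  have hN := cs.doubleCoset_union_right hC
  have hN' : cs.doubleCoset I' w (J ∪ J') = cs.doubleCoset I w J := by
    rw [Set.union_comm, cs.doubleCoset_union_right hC.symm, hC]
  have hinter := cs.doubleCoset_inter_left (hN ▸ h.length_le) (hN.trans hN'.symm)
  have hcard : I.ncard ≤ (I ∩ I').ncard := by
    rcases h.2 _ _ (hinter.trans hN) with hlt | ⟨heq, -⟩
    · exact hlt.le
    · exact heq.le
  rw [← Set.inter_eq_left]
  exact Set.eq_of_subset_of_ncard_le Set.inter_subset_left hcard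

theorem right_subset [Finite B] (h : cs.IsLexMinimalPresentation I w J)
    (hC : cs.doubleCoset I w J = cs.doubleCoset I w J') : J ⊆ J' := by
  have hcard : J.ncard ≤ (J ∩ J').ncard := by
    rcases h.2 _ _ (cs.doubleCoset_inter_right h.length_le hC) with hlt | ⟨-, hle⟩
    · exact absurd hlt (lt_irrefl _)
    · exact hle
  rw [← Set.inter_eq_left]
  exact Set.eq_of_subset_of_ncard_le Set.inter_subset_left hcard

end IsLexMinimalPresentation

theorem exists_isLexMinimalPresentation (I J : Set B) (w : W) :
    ∃ I' w' J', cs.doubleCoset I w J = cs.doubleCoset I' w' J' ∧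
      cs.IsLexMinimalPresentation I' w' J' := by
  obtain ⟨x, hx, hmin⟩ := cs.exists_forall_length_le ⟨w, cs.self_mem_doubleCoset I J w⟩
  obtain ⟨⟨I', J'⟩, hp, hlex⟩ := (InvImage.wf
    (fun p : Set B × Set B => toLex (p.1.ncard, p.2.ncard)) wellFounded_lt).has_min
    {p | cs.doubleCoset p.1 x p.2 = cs.doubleCoset I w J} ⟨(I, J), cs.doubleCoset_eq_of_mem hx⟩
  have hp' : cs.doubleCoset I' x J' = cs.doubleCoset I w J := hp
  refine ⟨I', x, J', hp'.symm, fun y hy => ?_, fun I₁ J₁ h₁ => ?_⟩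
  · exact cs.length_lt_of_mem_doubleCoset (hp'.symm ▸ hmin) hy
  · have h₂ := hlex (I₁, J₁) (h₁.trans hp')
    simp only [InvImage, Prod.Lex.toLex_lt_toLex] at h₂
    omega

end CoxeterSystem

/-- Every parabolic double coset of a Coxeter system of finite rank has a unique
lex-minimal presentation. -/
theorem exists_unique_lex_minimal_presentation
    [Fintype B] {M : CoxeterMatrix B} (cs : CoxeterSystem M W)
    (C : Set W) (hC : ∃ (I : Set B) (w : W) (J : Set B), C = cs.doubleCoset I w J) :
    ∃! p : Set B × W × Set B,
      C = cs.doubleCoset p.1 p.2.1 p.2.2 ∧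
      cs.IsLexMinimalPresentation p.1 p.2.1 p.2.2 := by
  obtain ⟨I, w, J, rfl⟩ := hC
  obtain ⟨I', w', J', hC', hmin⟩ := cs.exists_isLexMinimalPresentation I J w
  refine ⟨(I', w', J'), ⟨hC', hmin⟩, ?_⟩
  rintro ⟨I₁, w₁, J₁⟩ ⟨hC₁, hmin₁⟩
  dsimp only at hC₁ hmin₁
  have h : cs.doubleCoset I₁ w₁ J₁ = cs.doubleCoset I' w' J' := hC₁.symm.trans hC'
  obtain rfl := hmin₁.element_eq hmin h
  obtain rfl := (hmin₁.left_subset h).antisymm (hmin.left_subset h.symm)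
  obtain rfl := (hmin₁.right_subset h).antisymm (hmin.right_subset h.symm)
  rfl
end

section
/- Let w ∈ S_n, let I be a subset of the left ascent set of w, and let J be a subset of the right ascent set of w. Then W_I w W_J is the lex-minimal presentation of its parabolic double coset if and only if both of the following hold: (1) whenever a, b with a ≤ b satisfy {a−1, a, …, b, b+1} ∩ I = {a, …, b} and each of a, …, b is a small left ascent of w, then {w⁻¹(a), …, w⁻¹(b)} is not contained in J and {w⁻¹(a)−1, w⁻¹(a), …, w⁻¹(b), w⁻¹(b)+1} ∩ J ≠ ∅; and (2) whenever a, b with a ≤ b satisfy {a−1, a, …, b, b+1} ∩ J = {a, …, b} and each of a, …, b is a small right ascent of w, then {w(a), …, w(b)} is not contained in I. -/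
/-- The value of `w ∈ S_n` at the 1-indexed position `k` (so `permVal w k = w(k)` for
`1 ≤ k ≤ n`, and `permVal w k = k` otherwise). -/
def permVal {n : ℕ} (w : Equiv.Perm (Fin n)) (k : ℕ) : ℕ :=
  if h : 1 ≤ k ∧ k ≤ n then (w ⟨k - 1, by omega⟩ : ℕ) + 1 else k

/-- The adjacent transposition `s_i ∈ S_n`, swapping the 1-indexed positions
`i` and `i + 1`. -/
def adjT (n : ℕ) (i : ℕ) : Equiv.Perm (Fin n) :=
  if h : 1 ≤ i ∧ i + 1 ≤ n then Equiv.swap ⟨i - 1, by omega⟩ ⟨i, by omega⟩ else 1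

/-- The Coxeter length of `w ∈ S_n`, i.e. its number of inversions. -/
noncomputable def invLength {n : ℕ} (w : Equiv.Perm (Fin n)) : ℕ :=
  Set.ncard {p : Fin n × Fin n | p.1 < p.2 ∧ w p.2 < w p.1}

/-- The Young subgroup `W_I` of `S_n` generated by the adjacent transpositions `s_i`,
`i ∈ I`. -/
def youngSubgroup (n : ℕ) (I : Set ℕ) : Subgroup (Equiv.Perm (Fin n)) :=
  Subgroup.closure {x | ∃ i ∈ I, x = adjT n i}

/-- The parabolic double coset `W_I w W_J` in `S_n`. -/
def doubleCosetS (n : ℕ) (I : Set ℕ) (w : Equiv.Perm (Fin n)) (J : Set ℕ) :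
    Set (Equiv.Perm (Fin n)) :=
  {x | ∃ u ∈ youngSubgroup n I, ∃ v ∈ youngSubgroup n J, x = u * w * v}

/-- `j` is a small right ascent of `w ∈ S_n` if `1 ≤ j ≤ n - 1` and `w(j+1) = w(j) + 1`. -/
def IsSmallRightAscent {n : ℕ} (w : Equiv.Perm (Fin n)) (j : ℕ) : Prop :=
  1 ≤ j ∧ j + 1 ≤ n ∧ permVal w (j + 1) = permVal w j + 1

/-- `(I, w, J)` is a lex-minimal presentation of the parabolic double coset `W_I w W_J`
of `S_n`: `w` is the unique minimal-length element, and `(|I|, |J|)` is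
lexicographically minimal among all presentations of the coset with the same `w`. -/
def IsLexMinimalS {n : ℕ} (I : Set ℕ) (w : Equiv.Perm (Fin n)) (J : Set ℕ) : Prop :=
  (∀ x ∈ doubleCosetS n I w J, x ≠ w → invLength w < invLength x) ∧
  (∀ I' J' : Set ℕ, I' ⊆ Set.Icc 1 (n - 1) → J' ⊆ Set.Icc 1 (n - 1) →
    doubleCosetS n I' w J' = doubleCosetS n I w J →
    I.ncard < I'.ncard ∨ (I.ncard = I'.ncard ∧ J.ncard ≤ J'.ncard))

section PermVal

variable {n : ℕ}

theorem permVal_one (k : ℕ) : permVal (1 : Equiv.Perm (Fin n)) k = k := by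
  unfold permVal
  split_ifs with h
  · simp; omega
  · rfl

theorem permVal_mul (u w : Equiv.Perm (Fin n)) (k : ℕ) :
    permVal (u * w) k = permVal u (permVal w k) := by
  by_cases h : 1 ≤ k ∧ k ≤ n
  · have h2 : 1 ≤ (w ⟨k - 1, by omega⟩ : ℕ) + 1 ∧ (w ⟨k - 1, by omega⟩ : ℕ) + 1 ≤ n :=
      ⟨by omega, by omega⟩
    have hw : permVal w k = (w ⟨k - 1, by omega⟩ : ℕ) + 1 := by simp [permVal, h]
    rw [hw]
    simp [permVal, h]
  · simp only [permVal, dif_neg h]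

theorem permVal_inv_apply (w : Equiv.Perm (Fin n)) (k : ℕ) :
    permVal w⁻¹ (permVal w k) = k := by
  rw [← permVal_mul, inv_mul_cancel, permVal_one]

theorem permVal_apply_inv (w : Equiv.Perm (Fin n)) (k : ℕ) :
    permVal w (permVal w⁻¹ k) = k := by
  rw [← permVal_mul, mul_inv_cancel, permVal_one]

theorem permVal_injective (w : Equiv.Perm (Fin n)) : Function.Injective (permVal w) :=
  Function.LeftInverse.injective (permVal_inv_apply w)

theorem permVal_succ (w : Equiv.Perm (Fin n)) (k : Fin n) :
    permVal w (k + 1) = (w k : ℕ) + 1 := by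
  have : 1 ≤ (k : ℕ) + 1 ∧ (k : ℕ) + 1 ≤ n := ⟨by omega, by omega⟩
  simp [permVal]

theorem permVal_ext {w y : Equiv.Perm (Fin n)} (h : ∀ k, permVal w k = permVal y k) : w = y := by
  ext k
  have := h (k + 1)
  rw [permVal_succ, permVal_succ] at this
  omega

theorem permVal_mem_range (w : Equiv.Perm (Fin n)) {k : ℕ} (h : 1 ≤ k ∧ k ≤ n) :
    1 ≤ permVal w k ∧ permVal w k ≤ n := by
  rw [permVal, dif_pos h]
  omega

theorem permVal_adjT {i : ℕ} (h : 1 ≤ i ∧ i + 1 ≤ n) (k : ℕ) :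
    permVal (adjT n i) k = Equiv.swap i (i + 1) k := by
  rw [adjT, dif_pos h]
  by_cases hk : 1 ≤ k ∧ k ≤ n
  · rw [permVal, dif_pos hk, Equiv.swap_apply_def, Equiv.swap_apply_def]
    simp only [Fin.ext_iff]
    split_ifs <;> simp <;> omega
  · rw [permVal, dif_neg hk, Equiv.swap_apply_def]
    split_ifs <;> omega

theorem adjT_of_not {i : ℕ} (h : ¬ (1 ≤ i ∧ i + 1 ≤ n)) : adjT n i = 1 := by
  rw [adjT, dif_neg h]

theorem adjT_commute {k l : ℕ} (h : k + 2 ≤ l ∨ l + 2 ≤ k) :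
    Commute (adjT n k) (adjT n l) := by
  by_cases hk : 1 ≤ k ∧ k + 1 ≤ n
  swap
  · rw [adjT_of_not hk]; exact Commute.one_left _
  by_cases hl : 1 ≤ l ∧ l + 1 ≤ n
  swap
  · rw [adjT_of_not hl]; exact Commute.one_right _
  refine permVal_ext fun q => ?_
  simp only [permVal_mul, permVal_adjT hk, permVal_adjT hl, Equiv.swap_apply_def]
  split_ifs <;> omega

theorem adjT_mul_of_small {w : Equiv.Perm (Fin n)} {k : ℕ} (h : IsSmallRightAscent w⁻¹ k) :
    adjT n k * w = w * adjT n (permVal w⁻¹ k) := by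
  obtain ⟨h1, h2, h3⟩ := h
  have hr := permVal_mem_range w⁻¹ (k := k) ⟨by omega, by omega⟩
  have hr' := permVal_mem_range w⁻¹ (k := k + 1) ⟨by omega, by omega⟩
  refine permVal_ext fun q => ?_
  rw [permVal_mul, permVal_mul, permVal_adjT ⟨h1, h2⟩, permVal_adjT ⟨hr.1, by omega⟩, ← h3]
  have e1 := permVal_apply_inv w k
  have e2 := permVal_apply_inv w (k + 1)
  have e3 := permVal_inv_apply w q
  simp only [Equiv.swap_apply_def]
  split_ifs <;> simp_all

end PermVal

section Rank

variable {n : ℕ}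

/-- The number of positions `q ≤ j` with value `w(q) ≤ i` (the position `0`, which is fixed
by `permVal w`, is counted too). -/
def cornerRank (w : Equiv.Perm (Fin n)) (i j : ℕ) : ℕ :=
  ((Finset.range (j + 1)).filter fun q => permVal w q ≤ i).card

theorem permVal_le_iff_of_mem_youngSubgroup {I : Set ℕ} {u : Equiv.Perm (Fin n)}
    (hu : u ∈ youngSubgroup n I) {i : ℕ} (hi : i ∉ I) (k : ℕ) : permVal u k ≤ i ↔ k ≤ i := by
  induction hu using Subgroup.closure_induction generalizing k with
  | mem x hx =>
    obtain ⟨m, hm, rfl⟩ := hx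
    have hne : m ≠ i := fun h => hi (h ▸ hm)
    by_cases h : 1 ≤ m ∧ m + 1 ≤ n
    · rw [permVal_adjT h, Equiv.swap_apply_def]
      split_ifs <;> omega
    · rw [adjT_of_not h, permVal_one]
  | one => rw [permVal_one]
  | mul x y _ _ hx hy => rw [permVal_mul, hx, hy]
  | inv x _ hx => rw [← hx, permVal_apply_inv]

theorem cornerRank_eq {I J : Set ℕ} {w x : Equiv.Perm (Fin n)} (hx : x ∈ doubleCosetS n I w J)
    {i j : ℕ} (hi : i ∉ I) (hj : j ∉ J) : cornerRank x i j = cornerRank w i j := by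
  obtain ⟨u, hu, v, hv, rfl⟩ := hx
  refine Finset.card_bij (fun q _ => permVal v q) ?_ ?_ ?_
  · intro q hq
    simp only [Finset.mem_filter, Finset.mem_range, permVal_mul,
      permVal_le_iff_of_mem_youngSubgroup hu hi, Nat.lt_succ_iff] at hq ⊢
    exact ⟨(permVal_le_iff_of_mem_youngSubgroup hv hj q).2 hq.1, hq.2⟩
  · intro a _ b _ h
    exact permVal_injective v h
  · intro b hb
    refine ⟨permVal v⁻¹ b, ?_, permVal_apply_inv v b⟩
    simp only [Finset.mem_filter, Finset.mem_range, permVal_mul, permVal_apply_inv,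
      permVal_le_iff_of_mem_youngSubgroup hu hi, Nat.lt_succ_iff] at hb ⊢
    exact ⟨(permVal_le_iff_of_mem_youngSubgroup (inv_mem hv) hj b).2 hb.1, hb.2⟩

theorem cornerRank_lt {w y : Equiv.Perm (Fin n)} {i j k : ℕ}
    (h : ∀ q ≤ j, permVal y q ≤ i → permVal w q ≤ i)
    (hkj : k ≤ j) (hw : permVal w k ≤ i) (hy : i < permVal y k) :
    cornerRank y i j < cornerRank w i j := by
  refine Finset.card_lt_card (Finset.ssubset_iff_of_subset ?_ |>.2 ⟨k, ?_, ?_⟩)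
  · intro q hq
    simp only [Finset.mem_filter, Finset.mem_range] at hq ⊢
    exact ⟨hq.1, h q (by omega) hq.2⟩
  · simp only [Finset.mem_filter, Finset.mem_range]; omega
  · simp only [Finset.mem_filter, Finset.mem_range]; omega

theorem exists_mem_youngSubgroup_swap {I : Set ℕ} {c d : ℕ} (hc : 1 ≤ c) (hcd : c < d)
    (hd : d ≤ n) (h : ∀ k, c ≤ k → k < d → k ∈ I) :
    ∃ u ∈ youngSubgroup n I, ∀ k, permVal u k = Equiv.swap c d k := by
  induction d, hcd using Nat.le_induction with
  | base =>
    exact ⟨adjT n c, Subgroup.subset_closure ⟨c, h c le_rfl (by omega), rfl⟩,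
      permVal_adjT ⟨hc, hd⟩⟩
  | succ d hcd ih =>
    obtain ⟨u, hu, hu'⟩ := ih (by omega) fun k h1 h2 => h k h1 (by omega)
    have hs : adjT n d ∈ youngSubgroup n I :=
      Subgroup.subset_closure ⟨d, h d (by omega) (by omega), rfl⟩
    refine ⟨adjT n d * u * adjT n d, mul_mem (mul_mem hs hu) hs, fun k => ?_⟩
    simp only [permVal_mul, permVal_adjT (n := n) (i := d) ⟨by omega, hd⟩, hu',
      Equiv.swap_apply_def]
    split_ifs <;> omega

theorem mem_doubleCosetS_inv {I J : Set ℕ} {w x : Equiv.Perm (Fin n)} :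
    x⁻¹ ∈ doubleCosetS n J w⁻¹ I ↔ x ∈ doubleCosetS n I w J := by
  constructor
  · rintro ⟨v, hv, u, hu, h⟩
    refine ⟨u⁻¹, inv_mem hu, v⁻¹, inv_mem hv, ?_⟩
    rw [← inv_inv x, h]; group
  · rintro ⟨u, hu, v, hv, rfl⟩
    exact ⟨v⁻¹, inv_mem hv, u⁻¹, inv_mem hu, by group⟩

theorem doubleCosetS_inv_congr {I J I' J' : Set ℕ} {w : Equiv.Perm (Fin n)}
    (h : doubleCosetS n I' w J' = doubleCosetS n I w J) :
    doubleCosetS n J' w⁻¹ I' = doubleCosetS n J w⁻¹ I := by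
  ext x
  rw [← inv_inv x, mem_doubleCosetS_inv, mem_doubleCosetS_inv, h]

end Rank

section Blocks

/-- `J` consists of right ascents of `w`. -/
def RightAscents {n : ℕ} (w : Equiv.Perm (Fin n)) (J : Set ℕ) : Prop :=
  ∀ j ∈ J, 1 ≤ j ∧ j + 1 ≤ n ∧ permVal w j < permVal w (j + 1)

variable {n : ℕ} {w : Equiv.Perm (Fin n)} {I J I' J' : Set ℕ}

theorem RightAscents.lt (hJ : RightAscents w J) {a b : ℕ} (hab : a < b)
    (h : ∀ k, a ≤ k → k < b → k ∈ J) : permVal w a < permVal w b := by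
  induction b, hab using Nat.le_induction with
  | base => exact (hJ a (h a le_rfl (by omega))).2.2
  | succ b hab ih =>
    exact (ih fun k h1 h2 => h k h1 (by omega)).trans (hJ b (h b (by omega) (by omega))).2.2

theorem exists_block_end {n : ℕ} {I : Set ℕ} (hI : ∀ i ∈ I, i + 1 ≤ n) (c : ℕ) :
    ∃ d, c ≤ d ∧ d ∉ I ∧ ∀ k, c ≤ k → k < d → k ∈ I := by
  classical
  have hex : ∃ d, c ≤ d ∧ d ∉ I := ⟨c + n, by omega, fun h => by have := hI _ h; omega⟩
  refine ⟨Nat.find hex, (Nat.find_spec hex).1, (Nat.find_spec hex).2, fun k h1 h2 => ?_⟩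
  by_contra hk
  exact Nat.find_min hex h2 ⟨h1, hk⟩

theorem exists_block_start {I : Set ℕ} (hI : 0 ∉ I) (c : ℕ) :
    ∃ d, d ≤ c ∧ d ∉ I ∧ ∀ k, d < k → k ≤ c → k ∈ I := by
  induction c with
  | zero => exact ⟨0, le_rfl, hI, fun k _ _ => by omega⟩
  | succ c ih =>
    by_cases h : c + 1 ∈ I
    · obtain ⟨d, h1, h2, h3⟩ := ih
      refine ⟨d, by omega, h2, fun k hk hk' => ?_⟩
      rcases Nat.lt_or_ge c k with hck | hck
      · rwa [show k = c + 1 by omega]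
      · exact h3 k hk hck
    · exact ⟨c + 1, le_rfl, h, fun k _ _ => by omega⟩

theorem mem_of_between (hC : doubleCosetS n I' w J' = doubleCosetS n I w J)
    {c d i : ℕ} (hc : 1 ≤ c) (hd : d ≤ n) (hci : c ≤ i) (hid : i < d)
    (h : ∀ k, c ≤ k → k < d → k ∈ I) (hi : i ∉ I') {j : ℕ}
    (hj : (permVal w⁻¹ c ≤ j ∧ j < permVal w⁻¹ d) ∨ (permVal w⁻¹ d ≤ j ∧ j < permVal w⁻¹ c)) :
    j ∈ J' := by
  by_contra hjJ
  obtain ⟨u, hu, hu'⟩ := exists_mem_youngSubgroup_swap hc (by omega) hd h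
  have hx : u * w ∈ doubleCosetS n I' w J' := by
    rw [hC]; exact ⟨u, hu, 1, one_mem _, by simp⟩
  have hr := cornerRank_eq hx hi hjJ
  have hval : ∀ q, permVal (u * w) q = Equiv.swap c d (permVal w q) := fun q => by
    rw [permVal_mul, hu']
  have ec := permVal_apply_inv w c
  have ed := permVal_apply_inv w d
  have hq : ∀ q, permVal w⁻¹ (permVal w q) = q := permVal_inv_apply w
  rcases hj with ⟨h1, h2⟩ | ⟨h1, h2⟩
  · refine (cornerRank_lt (k := permVal w⁻¹ c) (fun q hqj hle => ?_) h1 (by omega) ?_).ne hr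
    · rw [hval, Equiv.swap_apply_def] at hle
      have := hq q
      grind
    · rw [hval, ec, Equiv.swap_apply_left]; exact hid
  · refine (cornerRank_lt (k := permVal w⁻¹ d) (fun q hqj hle => ?_) h1 ?_ (by omega)).ne' hr
    · rw [hval, Equiv.swap_apply_def]
      have := hq q
      grind
    · rw [hval, ed, Equiv.swap_apply_right]; exact hci

theorem rightAscents_inv_of_eq (hC : doubleCosetS n I' w J' = doubleCosetS n I w J)
    (hI : RightAscents w⁻¹ I) (hJ : RightAscents w J) (hI' : I' ⊆ Set.Icc 1 (n - 1)) :
    RightAscents w⁻¹ I' := by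
  intro i hi
  obtain ⟨h1, h2⟩ := hI' hi
  refine ⟨h1, by omega, ?_⟩
  by_cases hiI : i ∈ I
  · exact (hI i hiI).2.2
  by_contra hlt
  have hne : permVal w⁻¹ i ≠ permVal w⁻¹ (i + 1) := fun h => by
    have := permVal_injective _ h; omega
  have := hJ.lt (a := permVal w⁻¹ (i + 1)) (b := permVal w⁻¹ i) (by omega) fun k hk hk' =>
    mem_of_between hC.symm (c := i) (d := i + 1) h1 (by omega) le_rfl (by omega)
      (fun k h1 h2 => by rwa [show k = i by omega]) hiI (Or.inr ⟨hk, hk'⟩)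
  rw [permVal_apply_inv, permVal_apply_inv] at this
  omega

theorem small_of_mem_diff (hC : doubleCosetS n I' w J' = doubleCosetS n I w J)
    (hI : RightAscents w⁻¹ I) (hJ' : RightAscents w J') {a b i : ℕ} (hai : a ≤ i) (hib : i ≤ b)
    (h : ∀ k, a ≤ k → k ≤ b → k ∈ I) (hi : i ∉ I') {k : ℕ} (hak : a ≤ k) (hkb : k ≤ b) :
    IsSmallRightAscent w⁻¹ k ∧ permVal w⁻¹ k ∈ J' := by
  have ha := hI a (h a le_rfl (by omega))
  have hb := hI b (h b (by omega) le_rfl)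
  have hk := hI k (h k hak hkb)
  have hmem : ∀ j, permVal w⁻¹ a ≤ j → j < permVal w⁻¹ (b + 1) → j ∈ J' := fun j h1 h2 =>
    mem_of_between hC (c := a) (d := b + 1) ha.1 hb.2.1 hai (by omega)
      (fun k h1 h2 => h k h1 (by omega)) hi (Or.inl ⟨h1, h2⟩)
  have hle1 : permVal w⁻¹ a ≤ permVal w⁻¹ k := by
    rcases hak.eq_or_lt with rfl | hlt
    · exact le_rfl
    · exact (hI.lt hlt fun m h1 h2 => h m h1 (by omega)).le
  have hle2 : permVal w⁻¹ (k + 1) ≤ permVal w⁻¹ (b + 1) := by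
    rcases hkb.eq_or_lt with rfl | hlt
    · exact le_rfl
    · exact (hI.lt (Nat.succ_lt_succ hlt) fun m h1 h2 => h m (by omega) (by omega)).le
  refine ⟨⟨hk.1, hk.2.1, ?_⟩, hmem _ hle1 (by omega)⟩
  by_contra hne
  have h1 := hJ'.lt (a := permVal w⁻¹ k) (b := permVal w⁻¹ k + 1) (by omega) fun m h1 h2 =>
    hmem m (by omega) (by omega)
  have h2 := hJ'.lt (a := permVal w⁻¹ k + 1) (b := permVal w⁻¹ (k + 1)) (by omega) fun m h1 h2 =>
    hmem m (by omega) (by omega)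
  rw [permVal_apply_inv] at h1 h2
  omega

theorem small_of_mem_diff_right (hC : doubleCosetS n I' w J' = doubleCosetS n I w J)
    (hJ : RightAscents w J) (hI' : RightAscents w⁻¹ I') {a b i : ℕ} (hai : a ≤ i) (hib : i ≤ b)
    (h : ∀ k, a ≤ k → k ≤ b → k ∈ J) (hi : i ∉ J') {k : ℕ} (hak : a ≤ k) (hkb : k ≤ b) :
    IsSmallRightAscent w k ∧ permVal w k ∈ I' := by
  have := small_of_mem_diff (w := w⁻¹) (doubleCosetS_inv_congr hC) (by rwa [inv_inv]) hI' hai hib h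
    hi hak hkb
  rwa [inv_inv] at this

theorem not_crossing_right (hC : doubleCosetS n I' w J' = doubleCosetS n I w J)
    {p e : ℕ} (hpe : p < e) (he : e + 1 ≤ n) (hlt : permVal w p + 1 < permVal w (e + 1))
    (hp1 : permVal w (p + 1) = permVal w p + 1)
    (hp : permVal w p ∈ I) (hW : 1 ≤ permVal w p ∧ permVal w p + 1 ≤ n) (hp' : permVal w p ∉ I')
    (hJ : ∀ k, p < k → k ≤ e → k ∈ J) (he' : e ∉ J') : False := by
  obtain ⟨v, hv, hv'⟩ := exists_mem_youngSubgroup_swap (n := n) (I := J) (c := p + 1) (d := e + 1)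
    (by omega) (by omega) he fun k h1 h2 => hJ k h1 (by omega)
  have hx : adjT n (permVal w p) * w * v ∈ doubleCosetS n I' w J' := by
    rw [hC]; exact ⟨_, Subgroup.subset_closure ⟨_, hp, rfl⟩, v, hv, rfl⟩
  have hr := cornerRank_eq hx hp' he'
  have hval : ∀ q, permVal (adjT n (permVal w p) * w * v) q =
      Equiv.swap (permVal w p) (permVal w p + 1) (permVal w (Equiv.swap (p + 1) (e + 1) q)) :=
    fun q => by rw [permVal_mul, permVal_mul, hv', permVal_adjT hW]
  refine (cornerRank_lt (k := p) (fun q hqj hle => ?_) hpe.le le_rfl ?_).ne hr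
  · rw [hval] at hle
    have hinj : permVal w q = permVal w (p + 1) → q = p + 1 := fun h => permVal_injective w h
    by_cases h1 : q = p + 1
    · subst h1
      rw [Equiv.swap_apply_left, Equiv.swap_apply_of_ne_of_ne (by omega) (by omega)] at hle
      omega
    · rw [Equiv.swap_apply_of_ne_of_ne h1 (by omega), Equiv.swap_apply_def] at hle
      split_ifs at hle <;> omega
  · rw [hval, Equiv.swap_apply_of_ne_of_ne (a := p + 1) (b := e + 1) (by omega) (by omega),
      Equiv.swap_apply_left]
    omega

theorem not_crossing_left (hC : doubleCosetS n I' w J' = doubleCosetS n I w J)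
    {p e : ℕ} (hep : e < p) (he : 1 ≤ e) (hpn : p ≤ n) (hlt : permVal w e ≤ permVal w p)
    (hp1 : permVal w (p + 1) = permVal w p + 1)
    (hp : permVal w p ∈ I) (hW : 1 ≤ permVal w p ∧ permVal w p + 1 ≤ n) (hp' : permVal w p ∉ I')
    (hJ : ∀ k, e ≤ k → k < p → k ∈ J) (he' : e ∉ J') : False := by
  obtain ⟨v, hv, hv'⟩ := exists_mem_youngSubgroup_swap (n := n) (I := J) he hep hpn hJ
  have hx : adjT n (permVal w p) * w * v ∈ doubleCosetS n I' w J' := by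
    rw [hC]; exact ⟨_, Subgroup.subset_closure ⟨_, hp, rfl⟩, v, hv, rfl⟩
  have hr := cornerRank_eq hx hp' he'
  have hval : ∀ q, permVal (adjT n (permVal w p) * w * v) q =
      Equiv.swap (permVal w p) (permVal w p + 1) (permVal w (Equiv.swap e p q)) :=
    fun q => by rw [permVal_mul, permVal_mul, hv', permVal_adjT hW]
  refine (cornerRank_lt (k := e) (fun q hqj hle => ?_) le_rfl hlt ?_).ne hr
  · rw [hval] at hle
    have hinj : permVal w q = permVal w (p + 1) → q = p + 1 := fun h => permVal_injective w h
    by_cases h1 : q = e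
    · rw [h1]; exact hlt
    · rw [Equiv.swap_apply_of_ne_of_ne h1 (by omega), Equiv.swap_apply_def] at hle
      split_ifs at hle <;> omega
  · rw [hval, Equiv.swap_apply_left, Equiv.swap_apply_left]
    omega

end Blocks

section MinimalLength

variable {n : ℕ} {w : Equiv.Perm (Fin n)} {I J : Set ℕ}

theorem invLength_inv (w : Equiv.Perm (Fin n)) : invLength w⁻¹ = invLength w := by
  refine Set.ncard_congr (fun p _ => (w⁻¹ p.2, w⁻¹ p.1)) ?_ ?_ ?_
  · rintro ⟨a, b⟩ ⟨h1, h2⟩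
    exact ⟨h2, by simpa using h1⟩
  · rintro ⟨a, b⟩ ⟨c, d⟩ _ _ h
    simpa [and_comm] using h
  · rintro ⟨a, b⟩ ⟨h1, h2⟩
    exact ⟨(w b, w a), ⟨h2, by simpa using h1⟩, by simp⟩

theorem invLength_mul_adjT_lt {j : ℕ} (h1 : 1 ≤ j) (h2 : j + 1 ≤ n)
    (h : permVal w (j + 1) < permVal w j) : invLength (w * adjT n j) < invLength w := by
  have hs : ∀ a : Fin n, ((adjT n j a : Fin n) : ℕ) + 1 = Equiv.swap j (j + 1) ((a : ℕ) + 1) :=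
    fun a => by rw [← permVal_succ, permVal_adjT ⟨h1, h2⟩]
  set p : Fin n := ⟨j - 1, by omega⟩ with hp
  set q : Fin n := ⟨j, by omega⟩ with hq
  have hlt : w q < w p := by
    have e1 := permVal_succ w p
    have e2 := permVal_succ w q
    have e3 : (p : ℕ) + 1 = j := by simp [hp]; omega
    have e4 : (q : ℕ) = j := rfl
    rw [e3] at e1
    rw [e4] at e2
    rw [Fin.lt_def]
    omega
  set f : Fin n × Fin n → Fin n × Fin n := fun a => (adjT n j a.1, adjT n j a.2) with hf
  have hfi : Function.Injective f := by
    rintro ⟨a, b⟩ ⟨c, d⟩ hh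
    simpa [hf] using hh
  rw [invLength, invLength, ← Set.ncard_image_of_injective _ hfi]
  refine Set.ncard_lt_ncard ?_ (Set.toFinite _)
  rw [Set.ssubset_iff_of_subset]
  · refine ⟨(p, q), ⟨by rw [Fin.lt_def]; simp [hp, hq]; omega, hlt⟩, ?_⟩
    rintro ⟨⟨a, b⟩, ⟨hab, -⟩, hh⟩
    have ha := hs a
    have hb := hs b
    simp only [hf, Prod.mk.injEq] at hh
    rw [hh.1, Equiv.swap_apply_def] at ha
    rw [hh.2, Equiv.swap_apply_def] at hb
    simp only [hp, hq, Fin.lt_def] at ha hb hab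
    split_ifs at ha hb <;> omega
  · rintro _ ⟨⟨a, b⟩, ⟨hab, hw⟩, rfl⟩
    refine ⟨?_, by simpa using hw⟩
    have ha := hs a
    have hb := hs b
    by_cases hpq : a = p ∧ b = q
    · exfalso
      obtain ⟨rfl, rfl⟩ := hpq
      have e1 : adjT n j p = q := by
        have : (p : ℕ) + 1 = j := by simp [hp]; omega
        rw [this, Equiv.swap_apply_left] at ha
        ext; simp only [hq]; omega
      have e2 : adjT n j q = p := by
        have : (q : ℕ) = j := rfl
        rw [this, Equiv.swap_apply_right] at hb
        ext; simp only [hp]; omega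
      simp only [Equiv.Perm.mul_apply, e1, e2] at hw
      exact lt_asymm hw hlt
    · rw [Equiv.swap_apply_def] at ha hb
      simp only [hp, hq, Fin.ext_iff, Fin.lt_def, hf] at *
      split_ifs at ha hb <;> omega

theorem permVal_le_of_cornerRank_eq {y : Equiv.Perm (Fin n)} (hJn : ∀ j ∈ J, j + 1 ≤ n)
    (hIn : ∀ i ∈ I, i + 1 ≤ n)
    (hr : ∀ i j, i ∉ I → j ∉ J → cornerRank y i j = cornerRank w i j)
    (hJ : RightAscents y J) (hI : RightAscents y⁻¹ I) {k : ℕ}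
    (hk : ∀ q < k, permVal y q = permVal w q) : permVal y k ≤ permVal w k := by
  by_contra! hlt
  obtain ⟨i, hi1, hi2, hi3⟩ := exists_block_end hIn (permVal w k)
  obtain ⟨j, hj1, hj2, hj3⟩ := exists_block_end hJn k
  have hyi : i < permVal y k := by
    by_contra! hle
    have h1 := hI.lt hlt fun m h1 h2 => hi3 m h1 (by omega)
    rw [permVal_inv_apply] at h1
    have h2 := hk _ h1
    rw [permVal_apply_inv] at h2
    have := permVal_injective w h2
    omega
  refine (cornerRank_lt (k := k) (fun q hq hle => ?_) hj1 hi1 hyi).ne (hr i j hi2 hj2)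
  rcases lt_or_ge q k with hqk | hqk
  · rw [← hk q hqk]; exact hle
  · rcases hqk.eq_or_lt with rfl | hqk
    · omega
    · have := hJ.lt hqk fun m h1 h2 => hj3 m h1 (by omega)
      omega

theorem eq_of_mem_doubleCosetS {y : Equiv.Perm (Fin n)} (hy : y ∈ doubleCosetS n I w J)
    (hI : RightAscents w⁻¹ I) (hJ : RightAscents w J)
    (hIy : RightAscents y⁻¹ I) (hJy : RightAscents y J) : y = w := by
  refine permVal_ext fun k => ?_
  have hIn : ∀ i ∈ I, i + 1 ≤ n := fun i hi => (hI i hi).2.1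
  have hJn : ∀ j ∈ J, j + 1 ≤ n := fun j hj => (hJ j hj).2.1
  induction k using Nat.strong_induction_on with
  | _ k ih =>
    exact le_antisymm
      (permVal_le_of_cornerRank_eq hJn hIn (fun i j hi hj => cornerRank_eq hy hi hj) hJy hIy ih)
      (permVal_le_of_cornerRank_eq hJn hIn (fun i j hi hj => (cornerRank_eq hy hi hj).symm) hJ hI
        fun q hq => (ih q hq).symm)

theorem mul_adjT_mem_doubleCosetS {x : Equiv.Perm (Fin n)} (hx : x ∈ doubleCosetS n I w J) {j : ℕ}
    (hj : j ∈ J) : x * adjT n j ∈ doubleCosetS n I w J := by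
  obtain ⟨u, hu, v, hv, rfl⟩ := hx
  exact ⟨u, hu, v * adjT n j, mul_mem hv (Subgroup.subset_closure ⟨j, hj, rfl⟩), by group⟩

theorem invLength_lt_of_mem_doubleCosetS (hI : RightAscents w⁻¹ I) (hJ : RightAscents w J)
    {x : Equiv.Perm (Fin n)} (hx : x ∈ doubleCosetS n I w J) (hne : x ≠ w) :
    invLength w < invLength x := by
  induction hN : invLength x using Nat.strong_induction_on generalizing x with
  | _ N ih =>
  have step : ∀ y ∈ doubleCosetS n I w J, invLength y < invLength x → invLength w < N := by
    intro y hy hlt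
    by_cases hyw : y = w
    · rw [← hyw, ← hN]; exact hlt
    · have := ih (invLength y) (hN ▸ hlt) hy hyw rfl
      omega
  by_cases hJx : RightAscents x J
  · by_cases hIx : RightAscents x⁻¹ I
    · exact absurd (eq_of_mem_doubleCosetS hx hI hJ hIx hJx) hne
    · simp only [RightAscents, not_forall] at hIx
      obtain ⟨i, hi, hni⟩ := hIx
      obtain ⟨h1, h2, -⟩ := hI i hi
      have hne : permVal x⁻¹ i ≠ permVal x⁻¹ (i + 1) := fun h => by
        have := permVal_injective _ h; omega
      have hlt := invLength_mul_adjT_lt (w := x⁻¹) h1 h2 (by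
        by_contra hc; exact hni ⟨h1, h2, by omega⟩)
      refine step (x⁻¹ * adjT n i)⁻¹ ?_ (by rwa [invLength_inv, ← invLength_inv x])
      rw [← mem_doubleCosetS_inv, inv_inv]
      exact mul_adjT_mem_doubleCosetS (mem_doubleCosetS_inv.2 hx) hi
  · simp only [RightAscents, not_forall] at hJx
    obtain ⟨j, hj, hnj⟩ := hJx
    obtain ⟨h1, h2, -⟩ := hJ j hj
    have hne : permVal x j ≠ permVal x (j + 1) := fun h => by
      have := permVal_injective _ h; omega
    exact step _ (mul_adjT_mem_doubleCosetS hx hj) (invLength_mul_adjT_lt h1 h2 (by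
      by_contra hc; exact hnj ⟨h1, h2, by omega⟩))

end MinimalLength

section Minimality

variable {n : ℕ} {w : Equiv.Perm (Fin n)} {I J I' J' : Set ℕ}

theorem permVal_add_of_small {a b : ℕ} (h : ∀ k, a ≤ k → k ≤ b → IsSmallRightAscent w k) {k : ℕ}
    (hak : a ≤ k) (hkb : k ≤ b + 1) : permVal w k = permVal w a + (k - a) := by
  induction k, hak using Nat.le_induction with
  | base => simp
  | succ k hk ih =>
    have := (h k hk (by omega)).2.2
    have := ih (by omega)
    omega

theorem false_of_right_transition (hC : doubleCosetS n I' w J' = doubleCosetS n I w J)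
    (hI : RightAscents w⁻¹ I) (hJ : RightAscents w J) (hI' : RightAscents w⁻¹ I')
    (hJ' : RightAscents w J')
    (h2 : ∀ a b : ℕ, a ≤ b → (∀ k, a ≤ k → k ≤ b → k ∈ J) → (a - 1) ∉ J → (b + 1) ∉ J →
      (∀ k, a ≤ k → k ≤ b → IsSmallRightAscent w k) → ¬ (∀ k, a ≤ k → k ≤ b → permVal w k ∈ I))
    {b p : ℕ} (hb : b + 1 ∉ I)
    (hsm : ∀ k, permVal w p ≤ k → k ≤ b → permVal w⁻¹ k ∈ J')
    (hpb : permVal w p ≤ b) (hpI : permVal w p ∈ I)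
    (hpJ : p ∉ J) (hpJ' : p + 1 ∈ J) : False := by
  have hp' : p ∈ J' := by simpa only [permVal_inv_apply] using hsm _ le_rfl hpb
  obtain ⟨d, hd1, hd2, hd3⟩ := exists_block_end (fun j hj => (hJ j hj).2.1) (p + 1)
  have hpd : p + 1 < d := by
    rcases hd1.eq_or_lt with rfl | h
    · exact absurd hpJ' hd2
    · exact h
  obtain ⟨e, he1, he2, he3⟩ := exists_block_end (fun j hj => (hJ' j hj).2.1) p
  have hpe : p < e := by
    rcases he1.eq_or_lt with rfl | h
    · exact absurd hp' he2
    · exact h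
  have hsmall : ∀ k, p ≤ k → k < e → IsSmallRightAscent w k ∧ permVal w k ∈ I := fun k hk hk' =>
    small_of_mem_diff_right hC.symm hJ' hI (a := p) (b := e - 1) le_rfl (by omega)
      (fun m h1 h2 => he3 m h1 (by omega)) hpJ hk (by omega)
  by_cases hed : d ≤ e
  · exact h2 (p + 1) (d - 1) (by omega) (fun k h1 h2 => hd3 k h1 (by omega)) (by simpa using hpJ)
      (by rwa [Nat.sub_add_cancel (by omega)]) (fun k h1 h2 => (hsmall k (by omega) (by omega)).1)
      (fun k h1 h2 => (hsmall k (by omega) (by omega)).2)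
  push Not at hed
  have hsmall' : ∀ k, p + 1 ≤ k → k < d → IsSmallRightAscent w k ∧ permVal w k ∈ I' :=
    fun k hk hk' => small_of_mem_diff_right hC hJ hI' (a := p + 1) (b := d - 1) (i := e)
      (by omega) (by omega) (fun m h1 h2 => hd3 m h1 (by omega)) he2 hk (by omega)
  have hall : ∀ k, p ≤ k → k ≤ e → IsSmallRightAscent w k := fun k h1 h2 => by
    rcases h2.eq_or_lt with rfl | h2
    · exact (hsmall' k (by omega) hed).1
    · exact (hsmall k h1 h2).1
  have hadd : ∀ k, p ≤ k → k ≤ e + 1 → permVal w k = permVal w p + (k - p) := fun k =>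
    permVal_add_of_small hall
  have hWe := hadd e hpe.le (by omega)
  have hWe1 := hadd (e + 1) (by omega) le_rfl
  have hWp1 := hadd (p + 1) (by omega) (by omega)
  have hval : ∀ m, permVal w p ≤ m → m ≤ permVal w e → permVal w (p + (m - permVal w p)) = m :=
    fun m h1 h2 => by rw [hadd _ (by omega) (by omega)]; omega
  by_cases heI : permVal w e ∈ I
  · by_cases hle : permVal w e ≤ b
    · have := hsm _ (by omega) hle
      rw [permVal_inv_apply] at this
      exact he2 this
    · push Not at hle
      have h3 := hval (b + 1) (by omega) hle
      have h4 : p + (b + 1 - permVal w p) ≤ e := by omega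
      rcases h4.eq_or_lt with h4 | h4
      · rw [h4] at h3
        exact hb (h3 ▸ heI)
      · have := (hsmall _ (by omega) h4).2
        rw [h3] at this
        exact hb this
  · by_cases hpI' : permVal w p ∈ I'
    · have := (small_of_mem_diff hC.symm hI' hJ (a := permVal w p) (b := permVal w e)
        (i := permVal w e) (by omega) le_rfl (fun m h1 h2 => ?_) heI le_rfl (by omega)).2
      · rw [permVal_inv_apply] at this
        exact hpJ this
      · rcases h1.eq_or_lt with rfl | h1
        · exact hpI'
        · have := (hsmall' (p + (m - permVal w p)) (by omega) (by omega)).2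
          rwa [hval m h1.le h2] at this
    · exact not_crossing_right hC hpe (hall e hpe.le le_rfl).2.1 (by omega) (by omega) hpI
        ⟨(hI _ hpI).1, (hI _ hpI).2.1⟩ hpI' (fun k h1 h2 => hd3 k h1 (by omega)) he2

theorem false_of_left_transition (hC : doubleCosetS n I' w J' = doubleCosetS n I w J)
    (hI : RightAscents w⁻¹ I) (hJ : RightAscents w J) (hI' : RightAscents w⁻¹ I')
    (hJ' : RightAscents w J')
    (h2 : ∀ a b : ℕ, a ≤ b → (∀ k, a ≤ k → k ≤ b → k ∈ J) → (a - 1) ∉ J → (b + 1) ∉ J →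
      (∀ k, a ≤ k → k ≤ b → IsSmallRightAscent w k) → ¬ (∀ k, a ≤ k → k ≤ b → permVal w k ∈ I))
    {a p : ℕ} (ha : a - 1 ∉ I)
    (hsm : ∀ k, a ≤ k → k ≤ permVal w p → permVal w⁻¹ k ∈ J')
    (hap : a ≤ permVal w p) (hpI : permVal w p ∈ I)
    (hp1 : 1 ≤ p) (hpJ : p ∉ J) (hpJ' : p - 1 ∈ J) : False := by
  have hp' : p ∈ J' := by simpa only [permVal_inv_apply] using hsm _ hap le_rfl
  have hJ0 : 0 ∉ J := fun h => absurd (hJ 0 h).1 (by omega)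
  have hJ'0 : 0 ∉ J' := fun h => absurd (hJ' 0 h).1 (by omega)
  obtain ⟨d, hd1, hd2, hd3⟩ := exists_block_start hJ0 (p - 1)
  have hpd : d < p - 1 := by
    rcases hd1.eq_or_lt with rfl | h
    · exact absurd hpJ' hd2
    · exact h
  obtain ⟨e, he1, he2, he3⟩ := exists_block_start hJ'0 p
  have hpe : e < p := by
    rcases he1.eq_or_lt with rfl | h
    · exact absurd hp' he2
    · exact h
  have hsmall : ∀ k, e < k → k ≤ p → IsSmallRightAscent w k ∧ permVal w k ∈ I := fun k hk hk' =>
    small_of_mem_diff_right hC.symm hJ' hI (a := e + 1) (b := p) (by omega) le_rfl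
      (fun m h1 h2 => he3 m h1 (by omega)) hpJ hk (by omega)
  by_cases hed : e ≤ d
  · exact h2 (d + 1) (p - 1) (by omega) (fun k h1 h2 => hd3 k h1 (by omega)) (by simpa using hd2)
      (by rwa [Nat.sub_add_cancel (by omega)]) (fun k h1 h2 => (hsmall k (by omega) (by omega)).1)
      (fun k h1 h2 => (hsmall k (by omega) (by omega)).2)
  push Not at hed
  have hsmall' : ∀ k, d < k → k < p → IsSmallRightAscent w k ∧ permVal w k ∈ I' :=
    fun k hk hk' => small_of_mem_diff_right hC hJ hI' (a := d + 1) (b := p - 1) (i := e)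
      (by omega) (by omega) (fun m h1 h2 => hd3 m h1 (by omega)) he2 hk (by omega)
  have hall : ∀ k, e ≤ k → k ≤ p → IsSmallRightAscent w k := fun k h1 h2 => by
    rcases h1.eq_or_lt with rfl | h1
    · exact (hsmall' _ hed hpe).1
    · exact (hsmall k h1 h2).1
  have hadd : ∀ k, e ≤ k → k ≤ p + 1 → permVal w k = permVal w e + (k - e) := fun k =>
    permVal_add_of_small hall
  have hWp := hadd p hpe.le (by omega)
  have hWp1 := hadd (p + 1) (by omega) le_rfl
  have hval : ∀ m, permVal w e ≤ m → m ≤ permVal w p → permVal w (e + (m - permVal w e)) = m :=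
    fun m h1 h2 => by rw [hadd _ (by omega) (by omega)]; omega
  by_cases heI : permVal w e ∈ I
  · by_cases hle : a ≤ permVal w e
    · have := hsm _ hle (by omega)
      rw [permVal_inv_apply] at this
      exact he2 this
    · push Not at hle
      have h3 := hval (a - 1) (by omega) (by omega)
      have h4 : e ≤ e + (a - 1 - permVal w e) := by omega
      rcases h4.eq_or_lt with h4 | h4
      · rw [← h4] at h3
        exact ha (h3 ▸ heI)
      · have := (hsmall _ h4 (by omega)).2
        rw [h3] at this
        exact ha this
  · by_cases hpI' : permVal w p ∈ I'
    · have := (small_of_mem_diff hC.symm hI' hJ (a := permVal w e) (b := permVal w p)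
        (i := permVal w e) le_rfl (by omega) (fun m h1 h2 => ?_) heI (by omega) le_rfl).2
      · rw [permVal_inv_apply] at this
        exact hpJ this
      · rcases h2.eq_or_lt with rfl | h2
        · exact hpI'
        · have := (hsmall' (e + (m - permVal w e)) (by omega) (by omega)).2
          rwa [hval m h1 h2.le] at this
    · have hpn := (hall p hpe.le le_rfl).2.1
      exact not_crossing_left hC hpe (by omega) (by omega) (by omega) (by omega) hpI
        ⟨(hI _ hpI).1, (hI _ hpI).2.1⟩ hpI' (fun k h1 h2 => hd3 k (by omega) (by omega)) he2

theorem exists_component (hI : RightAscents w I) {i : ℕ} (hi : i ∈ I) :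
    ∃ a b, a ≤ i ∧ i ≤ b ∧ (∀ k, a ≤ k → k ≤ b → k ∈ I) ∧ a - 1 ∉ I ∧ b + 1 ∉ I := by
  obtain ⟨c, hc1, hc2, hc3⟩ := exists_block_start (fun h => absurd (hI 0 h).1 (by omega)) i
  obtain ⟨d, hd1, hd2, hd3⟩ := exists_block_end (fun j hj => (hI j hj).2.1) i
  have hci : c ≠ i := fun h => hc2 (h ▸ hi)
  have hdi : d ≠ i := fun h => hd2 (h ▸ hi)
  refine ⟨c + 1, d - 1, by omega, by omega, fun k h1 h2 => ?_, by simpa using hc2,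
    by rwa [Nat.sub_add_cancel (by omega)]⟩
  rcases le_total k i with h | h
  · exact hc3 k h1 h
  · exact hd3 k h (by omega)

theorem subset_of_doubleCosetS_eq (hC : doubleCosetS n I' w J' = doubleCosetS n I w J)
    (hI : RightAscents w⁻¹ I) (hJ : RightAscents w J) (hI' : RightAscents w⁻¹ I')
    (hJ' : RightAscents w J')
    (h1 : ∀ a b : ℕ, a ≤ b →
          (∀ k, a ≤ k → k ≤ b → k ∈ I) → (a - 1) ∉ I → (b + 1) ∉ I →
          (∀ k, a ≤ k → k ≤ b → IsSmallRightAscent w⁻¹ k) →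
          (¬ (∀ k, a ≤ k → k ≤ b → permVal w⁻¹ k ∈ J)) ∧
          (∃ m ∈ J, (∃ k, a ≤ k ∧ k ≤ b ∧ m = permVal w⁻¹ k) ∨
            m = permVal w⁻¹ a - 1 ∨ m = permVal w⁻¹ b + 1))
    (h2 : ∀ a b : ℕ, a ≤ b → (∀ k, a ≤ k → k ≤ b → k ∈ J) → (a - 1) ∉ J → (b + 1) ∉ J →
      (∀ k, a ≤ k → k ≤ b → IsSmallRightAscent w k) →
      ¬ (∀ k, a ≤ k → k ≤ b → permVal w k ∈ I)) : I ⊆ I' := by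
  intro i hi
  by_contra hi'
  obtain ⟨a, b, hai, hib, hab, ha, hb⟩ := exists_component hI hi
  have hsm : ∀ k, a ≤ k → k ≤ b → IsSmallRightAscent w⁻¹ k ∧ permVal w⁻¹ k ∈ J' := fun k h1 h2 =>
    small_of_mem_diff hC hI hJ' hai hib hab hi' h1 h2
  have hadd : ∀ k, a ≤ k → k ≤ b + 1 → permVal w⁻¹ k = permVal w⁻¹ a + (k - a) := fun k =>
    permVal_add_of_small fun k h1 h2 => (hsm k h1 h2).1
  set p := permVal w⁻¹ a with hp
  have hW : ∀ j, p ≤ j → j ≤ p + (b - a) → permVal w j = a + (j - p) := fun j h1 h2 => by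
    rw [← permVal_apply_inv w (a + (j - p)), hadd _ (by omega) (by omega)]
    congr 1; omega
  obtain ⟨hn, m, hm, hmem⟩ := h1 a b (by omega) hab ha hb fun k h1 h2 => (hsm k h1 h2).1
  push Not at hn
  obtain ⟨k, hk1, hk2, hk⟩ := hn
  rw [hadd k hk1 (by omega)] at hk
  have hm1 : 1 ≤ m := (hJ m hm).1
  have hp1 : 1 ≤ p := (hJ' _ (hsm a le_rfl (by omega)).2).1
  have hbounds : p ≤ m + 1 ∧ m ≤ p + (b - a) + 1 := by
    rcases hmem with ⟨t, ht1, ht2, ht⟩ | h | h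
    · rw [hadd t ht1 (by omega)] at ht; omega
    · omega
    · rw [hadd b (by omega) (by omega)] at h; omega
  rcases lt_or_ge (p + (k - a)) m with hlt | hge
  · obtain ⟨d, hd1, hd2, hd3⟩ := exists_block_start (I := J)
      (fun h => absurd (hJ 0 h).1 (by omega)) m
    have hdm : d ≠ m := fun h => hd2 (h ▸ hm)
    have hkd : p + (k - a) ≤ d := by
      by_contra! h
      exact hk (hd3 _ h hlt.le)
    have hWd := hW d (by omega) (by omega)
    exact false_of_right_transition hC hI hJ hI' hJ' h2 hb
      (fun k h1 h2 => (hsm k (by omega) h2).2) (p := d) (by omega)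
      (hWd ▸ hab _ (by omega) (by omega)) hd2 (hd3 _ (by omega) (by omega))
  · obtain ⟨d, hd1, hd2, hd3⟩ := exists_block_end (fun j hj => (hJ j hj).2.1) m
    have hdm : d ≠ m := fun h => hd2 (h ▸ hm)
    have hkd : d ≤ p + (k - a) := by
      by_contra! h
      exact hk (hd3 _ hge h)
    have hWd := hW d (by omega) (by omega)
    exact false_of_left_transition hC hI hJ hI' hJ' h2 ha
      (fun k h1 h2 => (hsm k (by omega) (by omega)).2) (p := d) (by omega)
      (hWd ▸ hab _ (by omega) (by omega)) (by omega) hd2 (hd3 _ (by omega) (by omega))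

theorem subset_right_of_doubleCosetS_eq (hC : doubleCosetS n I w J' = doubleCosetS n I w J)
    (hI : RightAscents w⁻¹ I) (hJ : RightAscents w J)
    (h2 : ∀ a b : ℕ, a ≤ b → (∀ k, a ≤ k → k ≤ b → k ∈ J) → (a - 1) ∉ J → (b + 1) ∉ J →
      (∀ k, a ≤ k → k ≤ b → IsSmallRightAscent w k) →
      ¬ (∀ k, a ≤ k → k ≤ b → permVal w k ∈ I)) : J ⊆ J' := by
  intro j hj
  by_contra hj'
  obtain ⟨a, b, haj, hjb, hab, ha, hb⟩ := exists_component hJ hj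
  have hsm : ∀ k, a ≤ k → k ≤ b → IsSmallRightAscent w k ∧ permVal w k ∈ I := fun k h1 h2 =>
    small_of_mem_diff_right hC hJ hI haj hjb hab hj' h1 h2
  exact h2 a b (by omega) hab ha hb (fun k h1 h2 => (hsm k h1 h2).1) fun k h1 h2 => (hsm k h1 h2).2

end Minimality

section Reduction

variable {n : ℕ} {w : Equiv.Perm (Fin n)} {I J D : Set ℕ}

theorem youngSubgroup_mono {A B : Set ℕ} (h : A ⊆ B) : youngSubgroup n A ≤ youngSubgroup n B :=
  Subgroup.closure_mono fun _ ⟨i, hi, hx⟩ => ⟨i, h hi, hx⟩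

theorem doubleCosetS_mono {A B A' B' : Set ℕ} (hA : A ⊆ A') (hB : B ⊆ B') :
    doubleCosetS n A w B ⊆ doubleCosetS n A' w B' :=
  fun _ ⟨u, hu, v, hv, hx⟩ => ⟨u, youngSubgroup_mono hA hu, v, youngSubgroup_mono hB hv, hx⟩

theorem commute_of_mem_youngSubgroup {A B : Set ℕ}
    (h : ∀ k ∈ A, ∀ l ∈ B, k + 2 ≤ l ∨ l + 2 ≤ k) {u v : Equiv.Perm (Fin n)}
    (hu : u ∈ youngSubgroup n A) (hv : v ∈ youngSubgroup n B) : Commute u v := by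
  induction hu using Subgroup.closure_induction with
  | mem x hx =>
    obtain ⟨k, hk, rfl⟩ := hx
    induction hv using Subgroup.closure_induction with
    | mem y hy =>
      obtain ⟨l, hl, rfl⟩ := hy
      exact adjT_commute (h k hk l hl)
    | one => exact Commute.one_right _
    | mul _ _ _ _ h1 h2 => exact h1.mul_right h2
    | inv _ _ h1 => exact h1.inv_right
  | one => exact Commute.one_left _
  | mul _ _ _ _ h1 h2 => exact h1.mul_left h2
  | inv _ _ h1 => exact h1.inv_left

theorem exists_mul_of_mem_youngSubgroup_union {A B : Set ℕ}
    (h : ∀ k ∈ A, ∀ l ∈ B, k + 2 ≤ l ∨ l + 2 ≤ k) {u : Equiv.Perm (Fin n)}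
    (hu : u ∈ youngSubgroup n (A ∪ B)) :
    ∃ x ∈ youngSubgroup n A, ∃ y ∈ youngSubgroup n B, u = x * y := by
  induction hu using Subgroup.closure_induction with
  | mem x hx =>
    obtain ⟨k, hk | hk, rfl⟩ := hx
    · exact ⟨_, Subgroup.subset_closure ⟨k, hk, rfl⟩, 1, one_mem _, by simp⟩
    · exact ⟨1, one_mem _, _, Subgroup.subset_closure ⟨k, hk, rfl⟩, by simp⟩
  | one => exact ⟨1, one_mem _, 1, one_mem _, by simp⟩
  | mul _ _ _ _ h1 h2 =>
    obtain ⟨x, hx, y, hy, rfl⟩ := h1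
    obtain ⟨x', hx', y', hy', rfl⟩ := h2
    refine ⟨x * x', mul_mem hx hx', y * y', mul_mem hy hy', ?_⟩
    have := (commute_of_mem_youngSubgroup h hx' hy).eq
    rw [mul_assoc x y, ← mul_assoc y x', ← this]
    group
  | inv _ _ h1 =>
    obtain ⟨x, hx, y, hy, rfl⟩ := h1
    refine ⟨x⁻¹, inv_mem hx, y⁻¹, inv_mem hy, ?_⟩
    rw [mul_inv_rev]
    exact ((commute_of_mem_youngSubgroup h hx hy).inv_inv).eq.symm

theorem conj_mem_youngSubgroup (hD : ∀ k ∈ D, IsSmallRightAscent w⁻¹ k)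
    {u : Equiv.Perm (Fin n)} (hu : u ∈ youngSubgroup n D) :
    w⁻¹ * u * w ∈ youngSubgroup n (permVal w⁻¹ '' D) := by
  induction hu using Subgroup.closure_induction with
  | mem x hx =>
    obtain ⟨k, hk, rfl⟩ := hx
    rw [mul_assoc, adjT_mul_of_small (hD k hk), inv_mul_cancel_left]
    exact Subgroup.subset_closure ⟨_, ⟨k, hk, rfl⟩, rfl⟩
  | one => simp
  | mul x y _ _ h1 h2 =>
    have := mul_mem h1 h2
    rwa [show w⁻¹ * x * w * (w⁻¹ * y * w) = w⁻¹ * (x * y) * w by group] at this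
  | inv x _ h1 =>
    have := inv_mem h1
    rwa [show (w⁻¹ * x * w)⁻¹ = w⁻¹ * x⁻¹ * w by group] at this

theorem conj_mem_youngSubgroup_image (hD : ∀ k ∈ D, IsSmallRightAscent w⁻¹ k)
    {v : Equiv.Perm (Fin n)} (hv : v ∈ youngSubgroup n (permVal w⁻¹ '' D)) :
    w * v * w⁻¹ ∈ youngSubgroup n D := by
  have := conj_mem_youngSubgroup (w := w⁻¹) (D := permVal w⁻¹ '' D) (u := v) ?_ hv
  · rw [inv_inv, Set.image_image] at this
    simpa [permVal_apply_inv] using this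
  · rintro _ ⟨k, hk, rfl⟩
    obtain ⟨h1, h2, h3⟩ := hD k hk
    have hr := permVal_mem_range w⁻¹ (k := k) ⟨by omega, by omega⟩
    have hr' := permVal_mem_range w⁻¹ (k := k + 1) ⟨by omega, by omega⟩
    refine ⟨hr.1, by omega, ?_⟩
    rw [← h3, inv_inv, permVal_apply_inv, permVal_apply_inv]

theorem doubleCosetS_subset_diff_union (hDI : D ⊆ I)
    (hcomm : ∀ k ∈ I \ D, ∀ l ∈ D, k + 2 ≤ l ∨ l + 2 ≤ k)
    (hD : ∀ k ∈ D, IsSmallRightAscent w⁻¹ k) :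
    doubleCosetS n I w J ⊆ doubleCosetS n (I \ D) w (permVal w⁻¹ '' D ∪ J) := by
  rintro _ ⟨u, hu, v, hv, rfl⟩
  rw [← Set.sdiff_union_of_subset hDI] at hu
  obtain ⟨x, hx, y, hy, rfl⟩ := exists_mul_of_mem_youngSubgroup_union hcomm hu
  refine ⟨x, hx, w⁻¹ * y * w * v, mul_mem (youngSubgroup_mono Set.subset_union_left
    (conj_mem_youngSubgroup hD hy)) (youngSubgroup_mono Set.subset_union_right hv), ?_⟩
  group

theorem doubleCosetS_diff_eq (hDI : D ⊆ I)
    (hcomm : ∀ k ∈ I \ D, ∀ l ∈ D, k + 2 ≤ l ∨ l + 2 ≤ k)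
    (hD : ∀ k ∈ D, IsSmallRightAscent w⁻¹ k) (hDJ : ∀ k ∈ D, permVal w⁻¹ k ∈ J) :
    doubleCosetS n (I \ D) w J = doubleCosetS n I w J := by
  refine (doubleCosetS_mono Set.sdiff_subset subset_rfl).antisymm ?_
  have := doubleCosetS_subset_diff_union (J := J) hDI hcomm hD
  rwa [Set.union_eq_right.2 (Set.image_subset_iff.2 hDJ)] at this

theorem doubleCosetS_diff_union_eq (hDI : D ⊆ I)
    (hcomm : ∀ k ∈ I \ D, ∀ l ∈ D, k + 2 ≤ l ∨ l + 2 ≤ k)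
    (hD : ∀ k ∈ D, IsSmallRightAscent w⁻¹ k)
    (hDJ : ∀ k ∈ permVal w⁻¹ '' D, ∀ l ∈ J, k + 2 ≤ l ∨ l + 2 ≤ k) :
    doubleCosetS n (I \ D) w (permVal w⁻¹ '' D ∪ J) = doubleCosetS n I w J := by
  refine Set.Subset.antisymm ?_ (doubleCosetS_subset_diff_union hDI hcomm hD)
  rintro _ ⟨u, hu, v, hv, rfl⟩
  obtain ⟨x, hx, y, hy, rfl⟩ := exists_mul_of_mem_youngSubgroup_union hDJ hv
  refine ⟨u * (w * x * w⁻¹), mul_mem (youngSubgroup_mono Set.sdiff_subset hu)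
    (youngSubgroup_mono hDI (conj_mem_youngSubgroup_image hD hx)), y, hy, ?_⟩
  group

theorem two_le_dist_of_component {a b : ℕ} (ha1 : 1 ≤ a) (ha : a - 1 ∉ I) (hb : b + 1 ∉ I) {k l : ℕ}
    (hk : k ∈ I \ Set.Icc a b) (hl : l ∈ Set.Icc a b) : k + 2 ≤ l ∨ l + 2 ≤ k := by
  obtain ⟨hkI, hk⟩ := hk
  have h1 : k ≠ a - 1 := fun h => ha (h ▸ hkI)
  have h2 : k ≠ b + 1 := fun h => hb (h ▸ hkI)
  simp only [Set.mem_Icc] at hk hl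
  omega

theorem RightAscents.subset_Icc (hJ : RightAscents w J) : J ⊆ Set.Icc 1 (n - 1) := fun j hj => by
  have := hJ j hj
  exact ⟨this.1, by omega⟩

theorem ncard_diff_Icc_lt (hI : RightAscents w I) {a b : ℕ} (hab : a ≤ b) (ha : a ∈ I) :
    (I \ Set.Icc a b).ncard < I.ncard :=
  Set.ncard_lt_ncard ((Set.ssubset_iff_of_subset Set.sdiff_subset).2
    ⟨a, ha, fun h => h.2 ⟨le_rfl, hab⟩⟩) ((Set.finite_Icc 1 (n - 1)).subset hI.subset_Icc)

end Reduction

/-- Characterization of lex-minimal presentations of parabolic double cosets of the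
symmetric group `S_n` (Theorem on lex-minimality in `S_n`). -/
theorem lex_minimal_characterization_symmetric_group
    {n : ℕ} (w : Equiv.Perm (Fin n)) (I J : Set ℕ)
    (hI : I ⊆ {i : ℕ | 1 ≤ i ∧ i + 1 ≤ n ∧ permVal w⁻¹ i < permVal w⁻¹ (i + 1)})
    (hJ : J ⊆ {j : ℕ | 1 ≤ j ∧ j + 1 ≤ n ∧ permVal w j < permVal w (j + 1)}) :
    IsLexMinimalS I w J ↔
      ((∀ a b : ℕ, a ≤ b →
          (∀ k, a ≤ k → k ≤ b → k ∈ I) → (a - 1) ∉ I → (b + 1) ∉ I →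
          (∀ k, a ≤ k → k ≤ b → IsSmallRightAscent w⁻¹ k) →
          (¬ (∀ k, a ≤ k → k ≤ b → permVal w⁻¹ k ∈ J)) ∧
          (∃ m ∈ J, (∃ k, a ≤ k ∧ k ≤ b ∧ m = permVal w⁻¹ k) ∨
            m = permVal w⁻¹ a - 1 ∨ m = permVal w⁻¹ b + 1)) ∧
       (∀ a b : ℕ, a ≤ b →
          (∀ k, a ≤ k → k ≤ b → k ∈ J) → (a - 1) ∉ J → (b + 1) ∉ J →
          (∀ k, a ≤ k → k ≤ b → IsSmallRightAscent w k) →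
          ¬ (∀ k, a ≤ k → k ≤ b → permVal w k ∈ I))) := by
  have hI' : RightAscents w⁻¹ I := hI
  have hJ' : RightAscents w J := hJ
  constructor
  · rintro ⟨-, hmin⟩
    refine ⟨fun a b hab hmem ha hb hsm => ⟨fun hDJ => ?_, ?_⟩, fun a b hab hmem ha hb hsm hDI => ?_⟩
    · have := hmin (I \ Set.Icc a b) J (Set.sdiff_subset.trans hI'.subset_Icc) hJ'.subset_Icc
        (doubleCosetS_diff_eq (fun k hk => hmem k hk.1 hk.2)
          (fun k hk l hl => two_le_dist_of_component (hI (hmem a le_rfl hab)).1 ha hb hk hl)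
          (fun k hk => hsm k hk.1 hk.2) fun k hk => hDJ k hk.1 hk.2)
      have := ncard_diff_Icc_lt hI' hab (hmem a le_rfl hab)
      omega
    · by_contra! hno
      have := hmin (I \ Set.Icc a b) (permVal w⁻¹ '' Set.Icc a b ∪ J)
        (Set.sdiff_subset.trans hI'.subset_Icc) (Set.union_subset ?_ hJ'.subset_Icc)
        (doubleCosetS_diff_union_eq (fun k hk => hmem k hk.1 hk.2)
          (fun k hk l hl => two_le_dist_of_component (hI (hmem a le_rfl hab)).1 ha hb hk hl)
          (fun k hk => hsm k hk.1 hk.2) ?_)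
      · have := ncard_diff_Icc_lt hI' hab (hmem a le_rfl hab)
        omega
      · rintro _ ⟨k, hk, rfl⟩
        obtain ⟨h1, h2, h3⟩ := hsm k hk.1 hk.2
        have hr := permVal_mem_range w⁻¹ (k := k) ⟨by omega, by omega⟩
        have hr' := permVal_mem_range w⁻¹ (k := k + 1) ⟨by omega, by omega⟩
        exact ⟨hr.1, by omega⟩
      · rintro _ ⟨k, ⟨hk1, hk2⟩, rfl⟩ l hl
        have hadd : ∀ k, a ≤ k → k ≤ b + 1 → permVal w⁻¹ k = permVal w⁻¹ a + (k - a) := fun k =>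
          permVal_add_of_small hsm
        obtain ⟨h1, h2, h3⟩ := hno l hl
        rw [hadd b hab (by omega)] at h3
        rw [hadd k hk1 (by omega)]
        have h4 : ¬ (permVal w⁻¹ a ≤ l ∧ l ≤ permVal w⁻¹ a + (b - a)) := fun ⟨h5, h6⟩ =>
          h1 (a + (l - permVal w⁻¹ a)) (by omega) (by omega) (by
            rw [hadd _ (by omega) (by omega)]; omega)
        omega
    · have := hmin I (J \ Set.Icc a b) hI'.subset_Icc (Set.sdiff_subset.trans hJ'.subset_Icc) (by
        have := doubleCosetS_inv_congr (doubleCosetS_diff_eq (w := w⁻¹) (I := J) (J := I)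
          (D := Set.Icc a b) (fun k hk => hmem k hk.1 hk.2)
          (fun k hk l hl => two_le_dist_of_component (hJ (hmem a le_rfl hab)).1 ha hb hk hl)
          (fun k hk => by rw [inv_inv]; exact hsm k hk.1 hk.2)
          fun k hk => by rw [inv_inv]; exact hDI k hk.1 hk.2)
        rwa [inv_inv] at this)
      have := ncard_diff_Icc_lt hJ' hab (hmem a le_rfl hab)
      omega
  · rintro ⟨h1, h2⟩
    refine ⟨fun x hx hne => invLength_lt_of_mem_doubleCosetS hI' hJ' hx hne,
      fun I₁ J₁ hI₁ hJ₁ hC => ?_⟩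
    have hIa : RightAscents w⁻¹ I₁ := rightAscents_inv_of_eq hC hI' hJ' hI₁
    have hJa : RightAscents w J₁ := by
      have := rightAscents_inv_of_eq (w := w⁻¹) (doubleCosetS_inv_congr hC) (by rwa [inv_inv]) hI' hJ₁
      rwa [inv_inv] at this
    have hsub := subset_of_doubleCosetS_eq hC hI' hJ' hIa hJa h1 h2
    have hfI : I₁.Finite := (Set.finite_Icc _ _).subset hI₁
    have hfJ : J₁.Finite := (Set.finite_Icc _ _).subset hJ₁
    rcases hsub.eq_or_ssubset with rfl | hss
    · exact Or.inr ⟨rfl, Set.ncard_le_ncard (subset_right_of_doubleCosetS_eq hC hI' hJ' h2) hfJ⟩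
    · exact Or.inl (Set.ncard_lt_ncard hss hfI)
end
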